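/- arXiv:1207.1235 — 3 statements merged into one kernel-verified Lean document; each statement's English description precedes it below -/
import Mathlib

section
/- For 0<α<1, the Mittag-Leffler function E_α(−t^α) = Σ_{j=0}^∞ (−1)^j t^{αj}/Γ(αj+1) satisfies E_α(−t^α) > 0 for all t > 0, and there exists a constant c > 0 such that E_α(−t^α) ≤ c/(1+t^α) ≤ c for all t > 0. -/
/-- The one-parameter Mittag-Leffler function `E_α`. -/
noncomputable def mlE (α x : ℝ) : ℝ := ∑' j : ℕ, x ^ j / Real.Gamma (α * j + 1)

open MeasureTheory Set Filter Topology

/-- `t^(a-1) E_{α,a}(-t^α)` -/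
noncomputable def mlF (α a t : ℝ) : ℝ :=
  t ^ (a - 1) * ∑' j : ℕ, (-(t ^ α)) ^ j / Real.Gamma (α * j + a)

lemma gamma_lower {s M : ℝ} (hs : 1 ≤ s) (hM : 0 < M) :
    Real.exp (-(M + 1)) * M ^ (s - 1) ≤ Real.Gamma s := by
  have hs0 : 0 < s := by linarith
  rw [Real.Gamma_eq_integral hs0]
  have hint := Real.GammaIntegral_convergent hs0
  have hsub : Ioc M (M + 1) ⊆ Ioi (0:ℝ) := fun x hx => hM.trans hx.1
  calc Real.exp (-(M + 1)) * M ^ (s - 1)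
      = ∫ x in Ioc M (M + 1), Real.exp (-(M + 1)) * M ^ (s - 1) := by
        simp
    _ ≤ ∫ x in Ioc M (M + 1), Real.exp (-x) * x ^ (s - 1) := by
        apply setIntegral_mono_on
        · exact integrableOn_const (by simp)
        · exact hint.mono_set hsub
        · exact measurableSet_Ioc
        · intro x hx
          have h1 : Real.exp (-(M + 1)) ≤ Real.exp (-x) := Real.exp_le_exp.2 (by linarith [hx.2])
          have h2 : M ^ (s - 1) ≤ x ^ (s - 1) :=
            Real.rpow_le_rpow hM.le hx.1.le (by linarith)
          gcongr
    _ ≤ _ := by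
        apply setIntegral_mono_set hint
        · filter_upwards [ae_restrict_mem measurableSet_Ioi] with x hx
          have : (0:ℝ) < x := hx
          simp only [Pi.zero_apply]
          positivity
        · exact hsub.eventuallyLE

lemma ml_summable {α a x : ℝ} (hα : 0 < α) (ha : 0 < a) (hx : 0 ≤ x) :
    Summable fun j : ℕ => x ^ j / Real.Gamma (α * j + a) := by
  obtain ⟨M, hM, hMx⟩ : ∃ M : ℝ, 0 < M ∧ M ^ α = 2 * x + 1 := by
    refine ⟨(2 * x + 1) ^ (1 / α), by positivity, ?_⟩
    rw [← Real.rpow_mul (by positivity)]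
    simp [hα.ne']
  have hgeo : Summable fun j : ℕ => (Real.exp (M + 1) * M ^ (1 - a)) * (x / (2 * x + 1)) ^ j := by
    apply Summable.mul_left
    apply summable_geometric_of_lt_one (by positivity)
    rw [div_lt_one (by positivity)]; linarith
  refine hgeo.of_norm_bounded_eventually_nat ?_
  obtain ⟨N, hN⟩ := exists_nat_gt (1 / α)
  filter_upwards [eventually_ge_atTop N] with j hj
  have hj1 : 1 ≤ α * j := by
    have : (N:ℝ) ≤ j := by exact_mod_cast hj
    have h2 : 1 / α < j := by linarith
    rw [div_lt_iff₀ hα] at h2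
    linarith
  have hG := gamma_lower (s := α * j + a) (M := M) (by linarith) hM
  have hGp : 0 < Real.exp (-(M + 1)) * M ^ (α * j + a - 1) := by positivity
  rw [Real.norm_of_nonneg (by have := hGp.trans_le hG; positivity)]
  calc x ^ j / Real.Gamma (α * j + a) ≤ x ^ j / (Real.exp (-(M + 1)) * M ^ (α * j + a - 1)) := by
        gcongr
    _ = _ := by
        have : α * j + a - 1 = α * j - (1 - a) := by ring
        rw [this, Real.rpow_sub hM, Real.rpow_mul hM.le, hMx, Real.rpow_natCast, Real.exp_neg,
          div_pow]
        field_simp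

lemma ml_summable' {α a x : ℝ} (hα : 0 < α) (ha : 0 < a) (hx : 0 ≤ x) :
    Summable fun j : ℕ => (-x) ^ j / Real.Gamma (α * j + a) := by
  refine (ml_summable hα ha hx).of_norm_bounded fun j => ?_
  have : 0 < Real.Gamma (α * j + a) := Real.Gamma_pos_of_pos (by positivity)
  rw [norm_div, norm_pow, norm_neg, Real.norm_of_nonneg hx, Real.norm_of_nonneg this.le]

lemma mlF_rec {α a t : ℝ} (hα : 0 < α) (ha : 0 < a) (ht : 0 < t) :
    mlF α a t = t ^ (a - 1) / Real.Gamma a - mlF α (a + α) t := by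
  unfold mlF
  have hs := ml_summable' hα ha (x := t ^ α) (by positivity)
  rw [hs.tsum_eq_zero_add]
  have h1 : ∀ j : ℕ, (-(t ^ α)) ^ (j + 1) / Real.Gamma (α * ((j + 1 : ℕ) : ℝ) + a)
      = (-(t ^ α)) * ((-(t ^ α)) ^ j / Real.Gamma (α * j + (a + α))) := by
    intro j
    have : α * ((j + 1 : ℕ) : ℝ) + a = α * j + (a + α) := by push_cast; ring
    rw [this]; ring
  simp_rw [h1]
  rw [tsum_mul_left]
  have : t ^ (a + α - 1) = t ^ (a - 1) * t ^ α := by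
    rw [← Real.rpow_add ht]; ring_nf
  rw [this]
  simp
  ring

lemma beta_int {a b t : ℝ} (ha : 0 < a) (hb : 0 < b) (ht : 0 < t) :
    ∫ s in (0:ℝ)..t, s ^ (a - 1) * (t - s) ^ (b - 1) =
      t ^ (a + b - 1) * (Real.Gamma a * Real.Gamma b / Real.Gamma (a + b)) := by
  have h := Complex.betaIntegral_scaled (a : ℂ) (b : ℂ) ht
  have h2 : ∫ x in (0:ℝ)..t, (x : ℂ) ^ ((a:ℂ) - 1) * ((t : ℂ) - x) ^ ((b:ℂ) - 1)
      = ∫ x in (0:ℝ)..t, ((x ^ (a - 1) * (t - x) ^ (b - 1) : ℝ) : ℂ) := by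
    apply intervalIntegral.integral_congr
    intro x hx
    rw [uIcc_of_le ht.le] at hx
    have e1 := Complex.ofReal_cpow hx.1 (a - 1)
    have e2 := Complex.ofReal_cpow (sub_nonneg.2 hx.2) (b - 1)
    push_cast at e1 e2
    simp only [Complex.ofReal_mul, e1, e2]
  rw [h2, intervalIntegral.integral_ofReal] at h
  have h3 := Complex.Gamma_mul_Gamma_eq_betaIntegral (s := (a:ℂ)) (t := (b:ℂ)) (by simpa) (by simpa)
  have hG : Real.Gamma (a + b) ≠ 0 := (Real.Gamma_pos_of_pos (by positivity)).ne'
  rw [← Complex.ofReal_add, Complex.Gamma_ofReal, Complex.Gamma_ofReal, Complex.Gamma_ofReal] at h3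
  have h4 : Complex.betaIntegral a b
      = ((Real.Gamma a * Real.Gamma b / Real.Gamma (a + b) : ℝ) : ℂ) := by
    push_cast
    rw [eq_div_iff (by exact_mod_cast hG), h3]; ring
  have e3 := Complex.ofReal_cpow ht.le (a + b - 1)
  push_cast at e3
  rw [h4, ← e3] at h
  exact_mod_cast h

lemma beta_integrable {a b t : ℝ} (ha : 0 < a) (hb : 0 < b) (ht : 0 < t) :
    IntervalIntegrable (fun s => s ^ (a - 1) * (t - s) ^ (b - 1)) volume 0 t := by
  apply intervalIntegral.intervalIntegrable_of_integral_ne_zero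
  rw [beta_int ha hb ht]
  have := Real.Gamma_pos_of_pos ha
  have := Real.Gamma_pos_of_pos hb
  have := Real.Gamma_pos_of_pos (add_pos ha hb)
  positivity

lemma mlF_cont {α a : ℝ} (hα : 0 < α) (ha : 0 < a) : ContinuousOn (mlF α a) (Ioi 0) := by
  intro t ht
  have ht0 : (0:ℝ) < t := ht
  apply ContinuousAt.continuousWithinAt
  unfold mlF
  apply ContinuousAt.mul
  · exact Real.continuousAt_rpow_const _ _ (Or.inl ht0.ne')
  · have : ContinuousOn (fun t : ℝ => ∑' j : ℕ, (-(t ^ α)) ^ j / Real.Gamma (α * j + a))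
        (Icc 0 (t + 1)) := by
      refine continuousOn_tsum ?_ (ml_summable hα ha (x := (t + 1) ^ α) (by positivity)) ?_
      · intro j
        apply Continuous.continuousOn
        have := Real.continuous_rpow_const hα.le
        fun_prop
      · intro j x hx
        have : 0 < Real.Gamma (α * j + a) := Real.Gamma_pos_of_pos (by positivity)
        have hx0 := hx.1
        rw [norm_div, norm_pow, norm_neg, Real.norm_of_nonneg (by positivity : 0 ≤ x ^ α),
          Real.norm_of_nonneg this.le]
        gcongr
        exact hx.2
    exact this.continuousAt (Icc_mem_nhds ht0 (by linarith))

lemma mlF_bound {α a T : ℝ} (hα : 0 < α) (ha : 0 < a) (hT : 0 < T) :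
    ∃ C > 0, ∀ s, 0 < s → s ≤ T → |mlF α a s| ≤ C * s ^ (a - 1) := by
  have hsum := ml_summable hα ha (x := T ^ α) (by positivity)
  have hG : ∀ j : ℕ, 0 < Real.Gamma (α * j + a) := fun j => Real.Gamma_pos_of_pos (by positivity)
  refine ⟨∑' j : ℕ, (T ^ α) ^ j / Real.Gamma (α * j + a), ?_, ?_⟩
  · refine hsum.tsum_pos (fun j => ?_) 0 ?_
    · have := hG j
      positivity
    · have := hG 0
      positivity
  · intro s hs hsT
    unfold mlF
    rw [abs_mul, abs_of_pos (by positivity : 0 < s ^ (a - 1)), mul_comm]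
    gcongr
    rw [← Real.norm_eq_abs]
    refine tsum_of_norm_bounded hsum.hasSum fun j => ?_
    rw [norm_div, norm_pow, norm_neg, Real.norm_of_nonneg (by positivity : 0 ≤ s ^ α),
          Real.norm_of_nonneg (hG j).le]
    have := hG j
    gcongr

lemma mlF_integrable {α a b t : ℝ} (hα : 0 < α) (ha : 0 < a) (hb : 0 < b) (ht : 0 < t) :
    IntervalIntegrable (fun s => mlF α a s * (t - s) ^ (b - 1)) volume 0 t := by
  obtain ⟨C, hC, h⟩ := mlF_bound hα ha ht
  have hb' := (beta_integrable ha hb ht).const_mul C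
  rw [intervalIntegrable_iff_integrableOn_Ioc_of_le ht.le] at hb' ⊢
  refine hb'.mono' ?_ ?_
  · apply AEStronglyMeasurable.mul
    · exact ((mlF_cont hα ha).mono (fun x hx => hx.1)).aestronglyMeasurable measurableSet_Ioc
    · apply Measurable.aestronglyMeasurable
      fun_prop
  · filter_upwards [ae_restrict_mem measurableSet_Ioc] with s hs
    have : 0 ≤ (t - s) ^ (b - 1) := Real.rpow_nonneg (by linarith [hs.2]) _
    rw [norm_mul, Real.norm_of_nonneg this, ← mul_assoc]
    gcongr
    exact h s hs.1 hs.2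

lemma mlF_integral {α a b t : ℝ} (hα : 0 < α) (ha : 0 < a) (hb : 0 < b) (ht : 0 < t) :
    ∫ s in (0:ℝ)..t, mlF α a s * (t - s) ^ (b - 1) = Real.Gamma b * mlF α (a + b) t := by
  have hG : ∀ j : ℕ, 0 < Real.Gamma (α * j + a) := fun j => Real.Gamma_pos_of_pos (by positivity)
  set F : ℕ → ℝ → ℝ := fun j s =>
    ((-1) ^ j / Real.Gamma (α * j + a)) * (s ^ (α * j + a - 1) * (t - s) ^ (b - 1)) with hF
  have hint : ∀ j, Integrable (F j) (volume.restrict (Ioc 0 t)) := by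
    intro j
    have := beta_integrable (a := α * j + a) (by positivity) hb ht
    rw [intervalIntegrable_iff_integrableOn_Ioc_of_le ht.le] at this
    exact this.const_mul _
  have hval : ∀ j : ℕ, ∫ s in Ioc 0 t, s ^ (α * j + a - 1) * (t - s) ^ (b - 1)
      = t ^ (a + b - 1) * (t ^ α) ^ j * (Real.Gamma (α * j + a) * Real.Gamma b
          / Real.Gamma (α * j + (a + b))) := by
    intro j
    rw [← intervalIntegral.integral_of_le ht.le, beta_int (by positivity) hb ht]
    rw [← Real.rpow_natCast, ← Real.rpow_mul ht.le, ← Real.rpow_add ht]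
    ring_nf
  have hnorm : ∀ j : ℕ, ∫ s in Ioc 0 t, ‖F j s‖
      = (Real.Gamma b * t ^ (a + b - 1)) * ((t ^ α) ^ j / Real.Gamma (α * j + (a + b))) := by
    intro j
    have : ∀ s ∈ Ioc 0 t, ‖F j s‖
        = (1 / Real.Gamma (α * j + a)) * (s ^ (α * j + a - 1) * (t - s) ^ (b - 1)) := by
      intro s hs
      have h1 : 0 ≤ (t - s) ^ (b - 1) := Real.rpow_nonneg (by linarith [hs.2]) _
      have h2 : 0 ≤ s ^ (α * j + a - 1) := Real.rpow_nonneg hs.1.le _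
      rw [hF]
      simp only [norm_mul, norm_div, norm_pow, norm_neg, norm_one, one_pow]
      rw [Real.norm_of_nonneg h1, Real.norm_of_nonneg h2, Real.norm_of_nonneg (hG j).le]
    rw [setIntegral_congr_fun measurableSet_Ioc this, integral_const_mul, hval]
    have := (hG j).ne'
    field_simp
  have hsum : Summable fun j => ∫ s in Ioc 0 t, ‖F j s‖ := by
    simp_rw [hnorm]
    exact (ml_summable hα (add_pos ha hb) (by positivity)).mul_left _
  have key := (hasSum_integral_of_summable_integral_norm hint hsum).tsum_eq
  rw [intervalIntegral.integral_of_le ht.le]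
  have e1 : ∫ s in Ioc 0 t, mlF α a s * (t - s) ^ (b - 1) = ∫ s in Ioc 0 t, ∑' j, F j s := by
    apply setIntegral_congr_fun measurableSet_Ioc
    intro s hs
    have hs0 : 0 < s := hs.1
    simp only [mlF, hF]
    rw [mul_assoc, mul_comm, mul_assoc, ← tsum_mul_right]
    apply tsum_congr
    intro j
    have : s ^ (α * j + a - 1) = (s ^ α) ^ j * s ^ (a - 1) := by
      rw [← Real.rpow_natCast, ← Real.rpow_mul hs0.le, ← Real.rpow_add hs0]; ring_nf
    rw [this, neg_pow]
    ring
  rw [e1, ← key]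
  unfold mlF
  rw [← mul_assoc, ← tsum_mul_left]
  apply tsum_congr
  intro j
  simp only [hF]
  rw [integral_const_mul, hval, neg_pow (t ^ α)]
  have := (hG j).ne'
  field_simp

lemma mlF_integrable_one {α a t : ℝ} (hα : 0 < α) (ha : 0 < a) (ht : 0 < t) :
    IntervalIntegrable (mlF α a) volume 0 t := by
  simpa using mlF_integrable hα ha one_pos ht

lemma mlF_integral_one {α a t : ℝ} (hα : 0 < α) (ha : 0 < a) (ht : 0 < t) :
    ∫ s in (0:ℝ)..t, mlF α a s = mlF α (a + 1) t := by
  simpa using mlF_integral hα ha one_pos ht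

lemma mlF_hasDerivAt {α a t : ℝ} (hα : 0 < α) (ha : 0 < a) (ht : 0 < t) :
    HasDerivAt (mlF α (a + 1)) (mlF α a t) t := by
  have h := intervalIntegral.integral_hasDerivAt_right (mlF_integrable_one hα ha ht)
    ((mlF_cont hα ha).stronglyMeasurableAtFilter isOpen_Ioi t ht)
    ((mlF_cont hα ha).continuousAt (Ioi_mem_nhds ht))
  refine h.congr_of_eventuallyEq ?_
  filter_upwards [Ioi_mem_nhds ht] with x hx
  exact (mlF_integral_one hα ha hx).symm

lemma mlF_differentiableAt {α : ℝ} (hα : 0 < α) (n : ℕ) : ∀ {a t : ℝ}, 0 < a → 0 < t →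
    1 < a + n * α → DifferentiableAt ℝ (mlF α a) t := by
  induction n with
  | zero =>
    intro a t ha ht h
    have := mlF_hasDerivAt (a := a - 1) hα (by simpa using h) ht
    rw [sub_add_cancel] at this
    exact this.differentiableAt
  | succ n ih =>
    intro a t ha ht h
    have h1 : DifferentiableAt ℝ (mlF α (a + α)) t :=
      ih (by positivity) ht (by push_cast at h; linarith)
    have h2 : DifferentiableAt ℝ (fun t : ℝ => t ^ (a - 1) / Real.Gamma a - mlF α (a + α) t) t :=
      ((Real.differentiableAt_rpow_const_of_ne _ ht.ne').div_const _).sub h1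
    refine h2.congr_of_eventuallyEq ?_
    filter_upwards [Ioi_mem_nhds ht] with x hx
    exact mlF_rec hα ha hx

lemma mlF_one {α t : ℝ} : mlF α 1 t = mlE α (-(t ^ α)) := by
  simp [mlF, mlE]

lemma mlF_one_rec {α t : ℝ} (hα : 0 < α) (ht : 0 < t) :
    mlF α 1 t = 1 - mlF α (α + 1) t := by
  have := mlF_rec hα one_pos ht
  simpa [add_comm] using this

lemma mlF_one_hasDerivAt {α t : ℝ} (hα : 0 < α) (ht : 0 < t) :
    HasDerivAt (mlF α 1) (-mlF α α t) t := by
  refine ((mlF_hasDerivAt hα hα ht).const_sub 1).congr_of_eventuallyEq ?_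
  filter_upwards [Ioi_mem_nhds ht] with x hx
  exact mlF_one_rec hα hx

lemma mlF_pos_near {α : ℝ} (hα : 0 < α) : ∃ δ > 0, ∀ t, 0 < t → t < δ → 0 < mlF α α t := by
  obtain ⟨C, hC, h⟩ := mlF_bound (a := α + α) hα (by positivity) one_pos
  have hG := Real.Gamma_pos_of_pos hα
  have hlim : Tendsto (fun t : ℝ => C * t ^ α) (𝓝 0) (𝓝 0) := by
    have := ((Real.continuous_rpow_const hα.le).tendsto 0).const_mul C
    simpa [Real.zero_rpow hα.ne'] using this
  have hev := hlim.eventually (gt_mem_nhds (show 0 < 1 / Real.Gamma α by positivity))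
  obtain ⟨δ, hδ, hd⟩ := Metric.eventually_nhds_iff.1 hev
  refine ⟨min δ 1, by positivity, fun t ht htd => ?_⟩
  have h1 : C * t ^ α < 1 / Real.Gamma α := by
    apply hd
    rw [Real.dist_eq, sub_zero, abs_of_pos ht]
    exact htd.trans_le (min_le_left _ _)
  have h2 := h t ht (htd.le.trans (min_le_right _ _))
  have h3 : t ^ (α + α - 1) = t ^ (α - 1) * t ^ α := by
    rw [← Real.rpow_add ht]; ring_nf
  rw [mlF_rec hα hα ht]
  have h4 := (abs_le.1 h2).2
  rw [h3] at h4
  have h5 : 0 < t ^ (α - 1) := by positivity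
  have : t ^ (α - 1) * (C * t ^ α) < t ^ (α - 1) * (1 / Real.Gamma α) := by gcongr
  have h6 : t ^ (α - 1) * (1 / Real.Gamma α) = t ^ (α - 1) / Real.Gamma α := by ring
  linarith

lemma kernel_diff {α A B T : ℝ} (hα : 0 < α) (hA : 0 < A) (hAB : A ≤ B) (hBT : B ≤ T) :
    B ^ (-α) - A ^ (-α) ≤ -(α * (B - A) * T ^ (-α - 1)) := by
  have hB : 0 < B := hA.trans_le hAB
  have hT : 0 < T := hB.trans_le hBT
  have h1 : 1 + α * ((B - A) / B) ≤ (B / A) ^ α := by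
    rw [Real.rpow_def_of_pos (by positivity)]
    have h2 := Real.one_sub_inv_le_log_of_pos (x := B / A) (by positivity)
    have h3 := Real.add_one_le_exp (Real.log (B / A) * α)
    have h4 : 1 - (B / A)⁻¹ = (B - A) / B := by field_simp
    rw [h4] at h2
    nlinarith
  have h2 : A ^ (-α) = B ^ (-α) * (B / A) ^ α := by
    rw [Real.div_rpow hB.le hA.le, Real.rpow_neg hA.le, Real.rpow_neg hB.le]
    have : B ^ α ≠ 0 := by positivity
    field_simp
  have h3 : B ^ (-α - 1) = B ^ (-α) / B := by rw [Real.rpow_sub hB, Real.rpow_one]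
  have h4 : T ^ (-α - 1) ≤ B ^ (-α - 1) := Real.rpow_le_rpow_of_nonpos hB hBT (by linarith)
  have h5 : B ^ (-α) * (1 + α * ((B - A) / B)) ≤ A ^ (-α) := by
    rw [h2]; gcongr
  have h6 : B ^ (-α) * (1 + α * ((B - A) / B)) = B ^ (-α) + α * (B - A) * B ^ (-α - 1) := by
    rw [h3]; ring
  have h7 : α * (B - A) * T ^ (-α - 1) ≤ α * (B - A) * B ^ (-α - 1) := by
    have : 0 ≤ B - A := by linarith
    gcongr
  linarith

lemma mlF_one_integral {α t : ℝ} (hα : 0 < α) (hα1 : α < 1) (ht : 0 < t) :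
    ∫ s in (0:ℝ)..t, mlF α α s * (t - s) ^ (-α) = Real.Gamma (1 - α) * mlF α 1 t := by
  have := mlF_integral (b := 1 - α) hα hα (by linarith) ht
  have e : 1 - α - 1 = -α := by ring
  rw [e, add_sub_cancel] at this
  exact this

lemma mlF_one_integrable {α t : ℝ} (hα : 0 < α) (hα1 : α < 1) (ht : 0 < t) :
    IntervalIntegrable (fun s => mlF α α s * (t - s) ^ (-α)) volume 0 t := by
  have := mlF_integrable (b := 1 - α) hα hα (by linarith) ht
  have e : 1 - α - 1 = -α := by ring
  rw [e] at this
  exact this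

/-- Key estimate. -/
lemma mlF_diff_est {α y T C : ℝ} (hα : 0 < α) (hα1 : α < 1) (hy : T / 2 ≤ y) (hyT : y < T)
    (hT : 0 < T) (hC : 0 ≤ C)
    (hpos : ∀ s, 0 < s → s < T → 0 < mlF α α s)
    (hlip : ∀ s, y ≤ s → s ≤ T → mlF α α s ≤ C * (T - s)) :
    Real.Gamma (1 - α) * (mlF α 1 T - mlF α 1 y) ≤
      (T - y) * (C * (T - y) ^ (1 - α)
        - α * T ^ (-α - 1) * ∫ s in (0:ℝ)..(T / 2), mlF α α s) := by
  have hy0 : 0 < y := by linarith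
  have iT := mlF_one_integrable hα hα1 hT
  have iy := mlF_one_integrable hα hα1 hy0
  have iTl : IntervalIntegrable (fun s => mlF α α s * (T - s) ^ (-α)) volume 0 y :=
    iT.mono_set (by rw [uIcc_of_le hy0.le, uIcc_of_le hT.le]; exact Icc_subset_Icc_right hyT.le)
  have iTr : IntervalIntegrable (fun s => mlF α α s * (T - s) ^ (-α)) volume y T :=
    iT.mono_set (by rw [uIcc_of_le hyT.le, uIcc_of_le hT.le]; exact Icc_subset_Icc_left hy0.le)
  have if0 := mlF_integrable_one hα hα hy0
  have if1 := mlF_integrable_one (t := T / 2) hα hα (by linarith)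
  rw [mul_sub, ← mlF_one_integral hα hα1 hT, ← mlF_one_integral hα hα1 hy0,
    ← intervalIntegral.integral_add_adjacent_intervals iTl iTr]
  have hr : ∫ s in y..T, mlF α α s * (T - s) ^ (-α) ≤ (T - y) * (C * (T - y) ^ (1 - α)) := by
    have : ∫ s in y..T, mlF α α s * (T - s) ^ (-α) ≤ ∫ s in y..T, C * (T - y) ^ (1 - α) := by
      apply intervalIntegral.integral_mono_on_of_le_Ioo hyT.le iTr (by simp)
      intro s hs
      have h0 : 0 < T - s := by linarith [hs.2]
      calc mlF α α s * (T - s) ^ (-α) ≤ C * (T - s) * (T - s) ^ (-α) := by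
            gcongr
            exact hlip s hs.1.le hs.2.le
        _ = C * (T - s) ^ (1 - α) := by
            rw [sub_eq_add_neg 1 α, Real.rpow_add h0, Real.rpow_one]; ring
        _ ≤ C * (T - y) ^ (1 - α) := by
            have : T - s ≤ T - y := by linarith [hs.1]
            have h' : 0 ≤ 1 - α := by linarith
            gcongr
    rwa [intervalIntegral.integral_const, smul_eq_mul] at this
  have hl : (∫ s in (0:ℝ)..y, mlF α α s * (T - s) ^ (-α))
      - ∫ s in (0:ℝ)..y, mlF α α s * (y - s) ^ (-α)
      ≤ -(α * (T - y) * T ^ (-α - 1)) * ∫ s in (0:ℝ)..y, mlF α α s := by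
    rw [← intervalIntegral.integral_sub iTl iy, ← intervalIntegral.integral_const_mul]
    apply intervalIntegral.integral_mono_on_of_le_Ioo hy0.le (iTl.sub iy) (if0.const_mul _)
    intro s hs
    have hk := kernel_diff (A := y - s) (B := T - s) (T := T) hα (by linarith [hs.2])
      (by linarith) (by linarith [hs.1])
    have hp := hpos s hs.1 (hs.2.trans hyT)
    have e : T - s - (y - s) = T - y := by ring
    rw [e] at hk
    nlinarith
  have hm : ∫ s in (0:ℝ)..(T / 2), mlF α α s ≤ ∫ s in (0:ℝ)..y, mlF α α s := by
    apply intervalIntegral.integral_mono_interval le_rfl (by linarith) hy ?_ if0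
    have : ∀ᵐ s ∂(volume.restrict (Ioc 0 y)), 0 ≤ mlF α α s := by
      filter_upwards [ae_restrict_mem measurableSet_Ioc] with s hs
      exact (hpos s hs.1 (hs.2.trans_lt hyT)).le
    exact this
  have hk : 0 ≤ α * (T - y) * T ^ (-α - 1) := by
    have : 0 < T - y := by linarith
    positivity
  have := mul_le_mul_of_nonneg_left hm hk
  nlinarith

lemma mlF_pos {α : ℝ} (hα : 0 < α) (hα1 : α < 1) {t : ℝ} (ht : 0 < t) : 0 < mlF α α t := by
  by_contra hneg
  push Not at hneg
  obtain ⟨δ, hδ, hd⟩ := mlF_pos_near hα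
  have hδt : δ ≤ t := by
    by_contra h
    exact absurd (hd t ht (not_le.1 h)) (not_lt.2 hneg)
  -- first zero
  have hcomp : IsCompact (Icc δ t ∩ mlF α α ⁻¹' Iic 0) := by
    apply isCompact_Icc.of_isClosed_subset _ inter_subset_left
    exact ((mlF_cont hα hα).mono (fun x hx => hδ.trans_le hx.1)).preimage_isClosed_of_isClosed
      isClosed_Icc isClosed_Iic
  obtain ⟨T, ⟨⟨hT1, hT2⟩, hT3⟩, hmin⟩ := hcomp.exists_isLeast ⟨t, ⟨hδt, le_rfl⟩, hneg⟩
  have hT3 : mlF α α T ≤ 0 := hT3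
  have hT0 : 0 < T := hδ.trans_le hT1
  have hpos : ∀ s, 0 < s → s < T → 0 < mlF α α s := by
    intro s hs hsT
    by_contra h
    push Not at h
    rcases lt_or_ge s δ with h1 | h1
    · exact absurd (hd s hs h1) (not_lt.2 h)
    · exact absurd (hmin ⟨⟨h1, hsT.le.trans hT2⟩, h⟩) (not_le.2 hsT)
  obtain ⟨n, hn⟩ := exists_nat_gt (1 / α)
  have hdiff : DifferentiableAt ℝ (mlF α α) T := by
    refine mlF_differentiableAt hα n hα hT0 ?_
    rw [div_lt_iff₀ hα] at hn
    linarith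
  obtain ⟨C, hC0, hC⟩ := hdiff.isBigO_sub.exists_pos
  rw [Asymptotics.isBigOWith_iff] at hC
  obtain ⟨ε, hε, hball⟩ := Metric.eventually_nhds_iff.1 hC
  have hlip : ∀ s, T - ε < s → s ≤ T → mlF α α s ≤ C * (T - s) := by
    intro s hs hsT
    have := hball (y := s) (by rw [Real.dist_eq, abs_sub_lt_iff]; constructor <;> linarith)
    rw [Real.norm_eq_abs, Real.norm_eq_abs, abs_sub_comm s T, abs_of_nonneg (by linarith : 0 ≤ T - s)]
      at this
    linarith [le_abs_self (mlF α α s - mlF α α T)]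
  set c := α * T ^ (-α - 1) * ∫ s in (0:ℝ)..(T / 2), mlF α α s with hc
  have hcpos : 0 < c := by
    have : 0 < ∫ s in (0:ℝ)..(T / 2), mlF α α s := by
      apply intervalIntegral.intervalIntegral_pos_of_pos_on
        (mlF_integrable_one hα hα (by linarith)) _ (by linarith)
      intro s hs
      exact hpos s hs.1 (by linarith [hs.2])
    positivity
  have hG := Real.Gamma_pos_of_pos (show 0 < 1 - α by linarith)
  have hder := (mlF_one_hasDerivAt hα hT0).hasDerivWithinAt (s := Iio T)
  rw [hasDerivWithinAt_iff_tendsto_slope' (by simp)] at hder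
  have hlim : Tendsto (fun y : ℝ => C * (T - y) ^ (1 - α)) (𝓝[<] T) (𝓝 0) := by
    have h1 : Continuous fun y : ℝ => C * (T - y) ^ (1 - α) := by
      have := Real.continuous_rpow_const (show 0 ≤ 1 - α by linarith)
      fun_prop
    have h2 := h1.tendsto T
    simp only [sub_self, Real.zero_rpow (show 1 - α ≠ 0 by linarith), mul_zero] at h2
    exact h2.mono_left nhdsWithin_le_nhds
  have hle : -mlF α α T ≤ -(c / 2) / Real.Gamma (1 - α) := by
    refine le_of_tendsto hder ?_
    filter_upwards [hlim.eventually (gt_mem_nhds (half_pos hcpos)), self_mem_nhdsWithin,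
      mem_nhdsWithin_of_mem_nhds (Ioi_mem_nhds (show max (T / 2) (T - ε) < T by
        rw [max_lt_iff]; constructor <;> linarith))] with y h1 h2 h3
    have h2 : y < T := h2
    have h3 : max (T / 2) (T - ε) < y := h3
    rw [max_lt_iff] at h3
    have := mlF_diff_est hα hα1 h3.1.le h2 hT0 hC0.le hpos
      (fun s hs hsT => hlip s (by linarith) hsT)
    rw [slope_comm, slope_def_field, div_le_div_iff₀ (by linarith) hG]
    have h4 : (T - y) * (C * (T - y) ^ (1 - α) - c) ≤ (T - y) * (-(c / 2)) := by
      apply mul_le_mul_of_nonneg_left _ (by linarith)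
      linarith
    linarith
  have : -(c / 2) / Real.Gamma (1 - α) < 0 := div_neg_of_neg_of_pos (by linarith) hG
  linarith

lemma mlF_one_pos {α : ℝ} (hα : 0 < α) (hα1 : α < 1) {t : ℝ} (ht : 0 < t) : 0 < mlF α 1 t := by
  have h := mlF_one_integral hα hα1 ht
  have hG := Real.Gamma_pos_of_pos (show 0 < 1 - α by linarith)
  have : 0 < ∫ s in (0:ℝ)..t, mlF α α s * (t - s) ^ (-α) := by
    apply intervalIntegral.intervalIntegral_pos_of_pos_on (mlF_one_integrable hα hα1 ht) _ ht
    intro s hs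
    have h1 := mlF_pos hα hα1 hs.1
    have h2 : 0 < t - s := by linarith [hs.2]
    positivity
  rw [h] at this
  exact (pos_iff_pos_of_mul_pos this).1 hG

lemma mlF_one_anti {α : ℝ} (hα : 0 < α) (hα1 : α < 1) : AntitoneOn (mlF α 1) (Ioi 0) := by
  refine antitoneOn_of_hasDerivWithinAt_nonpos (f' := fun t => -mlF α α t) (convex_Ioi 0)
    (mlF_cont hα one_pos) ?_ ?_
  · intro x hx
    rw [interior_Ioi] at hx
    exact (mlF_one_hasDerivAt hα hx).hasDerivWithinAt
  · intro x hx
    rw [interior_Ioi] at hx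
    linarith [mlF_pos hα hα1 hx]

lemma mlF_one_le {α : ℝ} (hα : 0 < α) (hα1 : α < 1) {t : ℝ} (ht : 0 < t) :
    mlF α 1 t * (1 + t ^ α / Real.Gamma (α + 1)) ≤ 1 := by
  have h := mlF_integral (a := 1) (b := α) hα one_pos hα ht
  have hi := mlF_integrable (a := 1) (b := α) hα one_pos hα ht
  have hG := Real.Gamma_pos_of_pos hα
  have hb := beta_int (a := 1) one_pos hα ht
  have hbi := beta_integrable (a := 1) one_pos hα ht
  simp only [sub_self, Real.rpow_zero, one_mul, Real.Gamma_one, add_sub_cancel_left] at hb hbi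
  have hle : mlF α 1 t * ∫ s in (0:ℝ)..t, (t - s) ^ (α - 1)
      ≤ ∫ s in (0:ℝ)..t, mlF α 1 s * (t - s) ^ (α - 1) := by
    rw [← intervalIntegral.integral_const_mul]
    apply intervalIntegral.integral_mono_on_of_le_Ioo ht.le (hbi.const_mul _) hi
    intro s hs
    have h2 : 0 < t - s := by linarith [hs.2]
    have := mlF_one_anti hα hα1 (mem_Ioi.2 hs.1) (mem_Ioi.2 ht) hs.2.le
    gcongr
  rw [hb, h, add_comm 1 α] at hle
  have hrec := mlF_one_rec hα ht
  have : mlF α 1 t * (t ^ α / Real.Gamma (α + 1)) ≤ mlF α (α + 1) t := by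
    refine le_of_mul_le_mul_left ?_ hG
    calc _ = _ := ?_
      _ ≤ _ := hle
    ring
  linarith

/-- Positivity and the bound `E_α(−t^α) ≤ c/(1+t^α) ≤ c`. -/
theorem mittagLeffler_neg_bound (α : ℝ) (hα : 0 < α) (hα1 : α < 1) :
    (∀ t > (0:ℝ), 0 < mlE α (-(t ^ α))) ∧
      ∃ c > (0:ℝ), ∀ t > (0:ℝ),
        mlE α (-(t ^ α)) ≤ c / (1 + t ^ α) ∧ c / (1 + t ^ α) ≤ c := by
  have hG : 0 < Real.Gamma (α + 1) := Real.Gamma_pos_of_pos (by linarith)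
  refine ⟨fun t ht => mlF_one ▸ mlF_one_pos hα hα1 ht, 1 + Real.Gamma (α + 1), by positivity,
    fun t ht => ?_⟩
  have h0 : 0 < t ^ α := by positivity
  constructor
  · rw [← mlF_one, le_div_iff₀ (by positivity)]
    have h1 := mlF_one_le hα hα1 ht
    have h2 := mlF_one_pos hα hα1 ht
    have h3 : 0 < t ^ α / Real.Gamma (α + 1) := by positivity
    have h4 : t ^ α = Real.Gamma (α + 1) * (t ^ α / Real.Gamma (α + 1)) := by field_simp
    rw [h4]
    set x := t ^ α / Real.Gamma (α + 1)
    have h5 : mlF α 1 t ≤ 1 := by nlinarith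
    have h6 : mlF α 1 t * x ≤ 1 := by nlinarith
    nlinarith
  · apply div_le_self (by positivity)
    linarith
end

section
/- Let 0<α<1 and w₀>0, and let w̃ be the solution of ᶜD₀₊^α w̃(t) = (w̃(t)+1/2)², w̃(0)=w₀. Then w̃ blows up in finite time T_{w̃} satisfying (Γ(α+1)/(4(w₀+1/2)))^{1/α} ≤ T_{w̃} ≤ (Γ(α+1)/(w₀+1/2))^{1/α}. -/
open Set intervalIntegral

namespace FracBlow

lemma ker_int {α : ℝ} (hα : 0 < α) (t a b : ℝ) :
    IntervalIntegrable (fun s => (t - s) ^ (α - 1)) MeasureTheory.volume a b := by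
  have h := (intervalIntegral.intervalIntegrable_rpow' (a := t - a) (b := t - b) (r := α - 1)
    (by linarith)).comp_sub_left t
  simpa using h

lemma ker_val {α : ℝ} (hα : 0 < α) (t a b : ℝ) :
    ∫ s in a..b, (t - s) ^ (α - 1) = ((t - a) ^ α - (t - b) ^ α) / α := by
  rw [intervalIntegral.integral_comp_sub_left (fun x => x ^ (α - 1)) t,
    integral_rpow (Or.inl (by linarith))]
  simp

lemma bdd_int {α : ℝ} (hα : 0 < α) {h : ℝ → ℝ} (hm : Measurable h) {B : ℝ}
    (h0 : ∀ s, 0 ≤ h s) (hB : ∀ s, h s ≤ B) (t a b : ℝ) :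
    IntervalIntegrable (fun s => (t - s) ^ (α - 1) * h s) MeasureTheory.volume a b := by
  have h1 := ker_int hα t a b
  rw [intervalIntegrable_iff] at h1 ⊢
  refine MeasureTheory.Integrable.mul_bdd (c := B) h1 hm.aestronglyMeasurable ?_
  filter_upwards with s
  rw [Real.norm_eq_abs, abs_of_nonneg (h0 s)]; exact hB s

lemma holder {α : ℝ} (hα : 0 < α) (hα1 : α < 1) {h : ℝ → ℝ} (hm : Measurable h) {B : ℝ}
    (h0 : ∀ s, 0 ≤ h s) (hB : ∀ s, h s ≤ B) {t t' : ℝ} (ht : 0 ≤ t) (htt : t ≤ t') :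
    |(∫ s in (0:ℝ)..t', (t' - s) ^ (α - 1) * h s) - ∫ s in (0:ℝ)..t, (t - s) ^ (α - 1) * h s|
      ≤ 2 * B / α * (t' - t) ^ α := by
  have hB0 : 0 ≤ B := (h0 0).trans (hB 0)
  rw [← integral_add_adjacent_intervals (bdd_int hα hm h0 hB t' 0 t) (bdd_int hα hm h0 hB t' t t')]
  have e2 : 0 ≤ ∫ s in t..t', (t' - s) ^ (α - 1) * h s := by
    apply intervalIntegral.integral_nonneg htt
    intro s hs
    exact mul_nonneg (Real.rpow_nonneg (by linarith [hs.2]) _) (h0 s)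
  have e3 : ∫ s in t..t', (t' - s) ^ (α - 1) * h s ≤ B * (((t' - t) ^ α) / α) := by
    have : ∫ s in t..t', (t' - s) ^ (α - 1) * h s ≤ ∫ s in t..t', (t' - s) ^ (α - 1) * B := by
      apply intervalIntegral.integral_mono_on htt (bdd_int hα hm h0 hB t' t t')
        ((ker_int hα t' t t').mul_const B)
      intro s hs
      exact mul_le_mul_of_nonneg_left (hB s) (Real.rpow_nonneg (by linarith [hs.2]) _)
    rw [intervalIntegral.integral_mul_const, ker_val hα, sub_self, Real.zero_rpow hα.ne', sub_zero,
      mul_comm] at this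
    exact this
  have key : ∀ s ∈ Ioo 0 t, (t' - s) ^ (α - 1) ≤ (t - s) ^ (α - 1) := by
    intro s hs
    exact Real.rpow_le_rpow_of_nonpos (by linarith [hs.2]) (by linarith) (by linarith)
  have i1 := bdd_int hα hm h0 hB t' 0 t
  have i2 := bdd_int hα hm h0 hB t 0 t
  have e4 : 0 ≤ (∫ s in (0:ℝ)..t, (t - s) ^ (α - 1) * h s)
      - ∫ s in (0:ℝ)..t, (t' - s) ^ (α - 1) * h s := by
    rw [sub_nonneg]
    apply intervalIntegral.integral_mono_on_of_le_Ioo ht i1 i2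
    intro s hs
    exact mul_le_mul_of_nonneg_right (key s hs) (h0 s)
  have e5 : (∫ s in (0:ℝ)..t, (t - s) ^ (α - 1) * h s)
      - (∫ s in (0:ℝ)..t, (t' - s) ^ (α - 1) * h s) ≤ B * ((t' - t) ^ α / α) := by
    rw [← intervalIntegral.integral_sub i2 i1]
    have : ∫ s in (0:ℝ)..t, ((t - s) ^ (α - 1) * h s - (t' - s) ^ (α - 1) * h s)
        ≤ ∫ s in (0:ℝ)..t, ((t - s) ^ (α - 1) - (t' - s) ^ (α - 1)) * B := by
      apply intervalIntegral.integral_mono_on_of_le_Ioo ht (i2.sub i1)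
        (((ker_int hα t 0 t).sub (ker_int hα t' 0 t)).mul_const B)
      intro s hs
      rw [← sub_mul]
      exact mul_le_mul_of_nonneg_left (hB s) (by linarith [key s hs])
    rw [intervalIntegral.integral_mul_const,
      intervalIntegral.integral_sub (ker_int hα t 0 t) (ker_int hα t' 0 t),
      ker_val hα, ker_val hα, sub_self, Real.zero_rpow hα.ne'] at this
    refine this.trans ?_
    rw [mul_comm]
    apply mul_le_mul_of_nonneg_left _ hB0
    rw [← sub_div]
    apply div_le_div_of_nonneg_right _ hα.le
    have := Real.rpow_le_rpow ht htt hα.le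
    simp only [sub_zero]
    linarith
  have : 2 * B / α * (t' - t) ^ α = B * ((t' - t) ^ α / α) + B * ((t' - t) ^ α / α) := by ring
  rw [this, abs_le]
  constructor <;> linarith

lemma frac_cont {α : ℝ} (hα : 0 < α) (hα1 : α < 1) {h : ℝ → ℝ} (hm : Measurable h) {B : ℝ}
    (h0 : ∀ s, 0 ≤ h s) (hB : ∀ s, h s ≤ B) :
    ContinuousOn (fun t => ∫ s in (0:ℝ)..t, (t - s) ^ (α - 1) * h s) (Ici 0) := by
  intro x hx
  rw [ContinuousWithinAt, tendsto_iff_dist_tendsto_zero]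
  have hl : Filter.Tendsto (fun y => 2 * B / α * |y - x| ^ α) (nhdsWithin x (Ici 0)) (nhds 0) := by
    have : Continuous (fun y => 2 * B / α * |y - x| ^ α) := by
      apply continuous_const.mul
      apply Continuous.rpow_const (by fun_prop)
      intro _; right; exact hα.le
    have h2 := this.tendsto x
    simp only [sub_self, abs_zero, Real.zero_rpow hα.ne', mul_zero] at h2
    exact h2.mono_left nhdsWithin_le_nhds
  refine squeeze_zero' (Filter.Eventually.of_forall fun _ => dist_nonneg) ?_ hl
  filter_upwards [self_mem_nhdsWithin] with y hy
  rw [Real.dist_eq]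
  rcases le_total x y with hxy | hxy
  · rw [abs_of_nonneg (sub_nonneg.2 hxy)]
    exact holder hα hα1 hm h0 hB hx hxy
  · rw [abs_sub_comm, abs_sub_comm y x, abs_of_nonneg (sub_nonneg.2 hxy)]
    exact holder hα hα1 hm h0 hB hy hxy

section sol
variable {α c u0 T : ℝ} {u : ℝ → ℝ}

lemma sol_int (hα : 0 < α) (hu : ContinuousOn u (Ico 0 T)) {a b : ℝ} (t : ℝ) (ha : 0 ≤ a)
    (hab : a ≤ b) (hb : b < T) :
    IntervalIntegrable (fun s => (t - s) ^ (α - 1) * u s ^ 2) MeasureTheory.volume a b := by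
  apply (ker_int hα t a b).mul_continuousOn
  rw [uIcc_of_le hab]
  exact (hu.mono fun s hs => ⟨ha.trans hs.1, hs.2.trans_lt hb⟩).pow 2

lemma sol_ge (hc : 0 < c)
    (eq : ∀ t ∈ Ico 0 T, u t = u0 + c * ∫ s in (0:ℝ)..t, (t - s) ^ (α - 1) * u s ^ 2)
    {t : ℝ} (ht : t ∈ Ico 0 T) : u0 ≤ u t := by
  rw [eq t ht]
  have : 0 ≤ ∫ s in (0:ℝ)..t, (t - s) ^ (α - 1) * u s ^ 2 := by
    apply intervalIntegral.integral_nonneg ht.1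
    intro s hs
    exact mul_nonneg (Real.rpow_nonneg (by linarith [hs.2]) _) (sq_nonneg _)
  nlinarith [mul_nonneg hc.le this]

lemma sol_mono (hα : 0 < α) (hc : 0 < c) (hu0 : 0 < u0) (hu : ContinuousOn u (Ico 0 T))
    (eq : ∀ t ∈ Ico 0 T, u t = u0 + c * ∫ s in (0:ℝ)..t, (t - s) ^ (α - 1) * u s ^ 2)
    {h t1 : ℝ} (hh : 0 < h) (ht1 : 0 ≤ t1) (htT : t1 + h < T) : u t1 < u (t1 + h) := by
  by_contra hcon
  push Not at hcon
  have hpos : ∀ s ∈ Ico 0 T, 0 < u s := fun s hs => hu0.trans_le (sol_ge hc eq hs)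
  have hD : ContinuousOn (fun t => u (t + h) - u t) (Icc 0 t1) := by
    apply ContinuousOn.sub
    · apply hu.comp (by fun_prop)
      intro s hs; exact ⟨by linarith [hs.1], by linarith [hs.2]⟩
    · exact hu.mono fun s hs => ⟨hs.1, by linarith [hs.2]⟩
  have hcl : IsClosed (Icc 0 t1 ∩ (fun t => u (t + h) - u t) ⁻¹' Iic 0) :=
    hD.preimage_isClosed_of_isClosed isClosed_Icc isClosed_Iic
  have hcp : IsCompact (Icc 0 t1 ∩ (fun t => u (t + h) - u t) ⁻¹' Iic 0) :=
    isCompact_Icc.of_isClosed_subset hcl inter_subset_left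
  obtain ⟨t, ⟨⟨ht0, htle⟩, htD⟩, hmin⟩ := hcp.exists_isLeast
    ⟨t1, ⟨ht1, le_rfl⟩, by simp only [mem_preimage, mem_Iic]; linarith⟩
  simp only [mem_preimage, mem_Iic] at htD
  have hlt : ∀ s ∈ Ico 0 t, u s < u (s + h) := by
    intro s hs
    by_contra hn
    have := hmin (show s ∈ _ from ⟨⟨hs.1, by linarith [hs.2]⟩, by
      simp only [mem_preimage, mem_Iic]; linarith⟩)
    linarith [hs.2]
  have e1 := eq t ⟨ht0, by linarith⟩
  have e2 := eq (t + h) ⟨by linarith, by linarith⟩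
  rw [← integral_add_adjacent_intervals (sol_int hα hu (t + h) le_rfl hh.le (by linarith))
    (sol_int hα hu (t + h) hh.le (by linarith) (by linarith))] at e2
  have p1 : 0 < ∫ s in (0:ℝ)..h, (t + h - s) ^ (α - 1) * u s ^ 2 := by
    apply intervalIntegral.intervalIntegral_pos_of_pos_on
      (sol_int hα hu (t + h) le_rfl hh.le (by linarith)) _ hh
    intro s hs
    exact mul_pos (Real.rpow_pos_of_pos (by linarith [hs.2]) _)
      (pow_pos (hpos s ⟨hs.1.le, by linarith [hs.2]⟩) 2)
  have p2 : ∫ s in h..(t + h), (t + h - s) ^ (α - 1) * u s ^ 2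
      = ∫ s in (0:ℝ)..t, (t - s) ^ (α - 1) * u (s + h) ^ 2 := by
    have := intervalIntegral.integral_comp_add_right (a := 0) (b := t)
      (fun s => (t + h - s) ^ (α - 1) * u s ^ 2) h
    rw [zero_add] at this
    rw [← this]
    congr 1; ext s; congr 2; ring
  have p3 : ∫ s in (0:ℝ)..t, (t - s) ^ (α - 1) * u s ^ 2
      ≤ ∫ s in (0:ℝ)..t, (t - s) ^ (α - 1) * u (s + h) ^ 2 := by
    apply intervalIntegral.integral_mono_on_of_le_Ioo ht0
      (sol_int hα hu t le_rfl ht0 (by linarith))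
    · apply (ker_int hα t 0 t).mul_continuousOn
      rw [uIcc_of_le ht0]
      apply ContinuousOn.pow
      apply hu.comp (by fun_prop)
      intro s hs; exact ⟨by linarith [hs.1], by linarith [hs.2]⟩
    · intro s hs
      apply mul_le_mul_of_nonneg_left _ (Real.rpow_nonneg (by linarith [hs.2]) _)
      exact pow_le_pow_left₀ (hpos s ⟨hs.1.le, by linarith [hs.2]⟩).le
        (hlt s ⟨hs.1.le, hs.2⟩).le 2
  rw [p2] at e2
  have : u t < u (t + h) := by
    rw [e1, e2]
    have := mul_lt_mul_of_pos_left (show (∫ s in (0:ℝ)..t, (t - s) ^ (α - 1) * u s ^ 2) <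
      (∫ s in (0:ℝ)..h, (t + h - s) ^ (α - 1) * u s ^ 2) +
      ∫ s in (0:ℝ)..t, (t - s) ^ (α - 1) * u (s + h) ^ 2 by linarith) hc
    linarith
  linarith

lemma sol_monoOn (hα : 0 < α) (hc : 0 < c) (hu0 : 0 < u0) (hu : ContinuousOn u (Ico 0 T))
    (eq : ∀ t ∈ Ico 0 T, u t = u0 + c * ∫ s in (0:ℝ)..t, (t - s) ^ (α - 1) * u s ^ 2) :
    MonotoneOn u (Ico 0 T) := by
  intro a ha b hb hab
  rcases hab.eq_or_lt with rfl | hab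
  · exact le_rfl
  have := sol_mono hα hc hu0 hu eq (h := b - a) (t1 := a) (by linarith) ha.1 (by linarith [hb.2])
  simpa using this.le

lemma sol_quad (hα : 0 < α) (hc : 0 < c) (hu0 : 0 < u0) (hu : ContinuousOn u (Ico 0 T))
    (eq : ∀ t ∈ Ico 0 T, u t = u0 + c * ∫ s in (0:ℝ)..t, (t - s) ^ (α - 1) * u s ^ 2)
    {t : ℝ} (ht : t ∈ Ico 0 T) : u t ≤ u0 + c * (t ^ α / α * u t ^ 2) := by
  have hm := sol_monoOn hα hc hu0 hu eq
  have : ∫ s in (0:ℝ)..t, (t - s) ^ (α - 1) * u s ^ 2 ≤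
      ∫ s in (0:ℝ)..t, (t - s) ^ (α - 1) * u t ^ 2 := by
    apply intervalIntegral.integral_mono_on ht.1 (sol_int hα hu t le_rfl ht.1 ht.2)
      ((ker_int hα t 0 t).mul_const _)
    intro s hs
    have hs' : s ∈ Ico 0 T := ⟨hs.1, hs.2.trans_lt ht.2⟩
    apply mul_le_mul_of_nonneg_left _ (Real.rpow_nonneg (by linarith [hs.2]) _)
    exact pow_le_pow_left₀ (hu0.le.trans (sol_ge hc eq hs')) (hm hs' ht hs.2) 2
  rw [intervalIntegral.integral_mul_const, ker_val hα, sub_self, Real.zero_rpow hα.ne', sub_zero,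
    sub_zero] at this
  have h2 := mul_le_mul_of_nonneg_left this hc.le
  linarith [eq t ht]

lemma sol_upper (hα : 0 < α) (hα1 : α < 1) (hc : 0 < c) (hu0 : 0 < u0)
    (hu : ContinuousOn u (Ico 0 T))
    (eq : ∀ t ∈ Ico 0 T, u t = u0 + c * ∫ s in (0:ℝ)..t, (t - s) ^ (α - 1) * u s ^ 2)
    {t1 : ℝ} (ht1 : t1 ∈ Ico 0 T) : c * (t1 ^ α / α) < 1 / u0 := by
  have hm := sol_monoOn hα hc hu0 hu eq
  have hpos : ∀ s ∈ Ico 0 T, 0 < u s := fun s hs => hu0.trans_le (sol_ge hc eq hs)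
  have hint : ∀ t ∈ Ico 0 T, IntervalIntegrable (fun s => s ^ (α - 1) * u s ^ 2)
      MeasureTheory.volume 0 t := by
    intro t ht
    apply (intervalIntegral.intervalIntegrable_rpow' (by linarith)).mul_continuousOn
    rw [uIcc_of_le ht.1]
    exact (hu.mono fun s hs => ⟨hs.1, hs.2.trans_lt ht.2⟩).pow 2
  have hcheb : ∀ t ∈ Ico 0 T, ∫ s in (0:ℝ)..t, s ^ (α - 1) * u s ^ 2 ≤
      ∫ s in (0:ℝ)..t, (t - s) ^ (α - 1) * u s ^ 2 := by
    intro t ht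
    have a1 := intervalIntegral.integral_comp_sub_left (a := 0) (b := t)
      (fun s => s ^ (α - 1) * u s ^ 2) t
    have a2 := intervalIntegral.integral_comp_sub_left (a := 0) (b := t)
      (fun s => (t - s) ^ (α - 1) * u s ^ 2) t
    simp only [sub_self, sub_zero, sub_sub_cancel] at a1 a2
    have i1 := hint t ht
    have i2 := sol_int hα hu t le_rfl ht.1 ht.2
    have i3 := i1.symm.comp_sub_left t
    have i4 := i2.symm.comp_sub_left t
    simp only [sub_self, sub_zero, sub_sub_cancel] at i3 i4
    have : (∫ s in (0:ℝ)..t, (s ^ (α - 1) * u s ^ 2 + (t - s) ^ (α - 1) * u (t - s) ^ 2)) ≤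
        ∫ s in (0:ℝ)..t, ((t - s) ^ (α - 1) * u s ^ 2 + s ^ (α - 1) * u (t - s) ^ 2) := by
      apply intervalIntegral.integral_mono_on_of_le_Ioo ht.1 (i1.add i3) (i2.add i4)
      intro s hs
      have hs1 : s ∈ Ico 0 T := ⟨hs.1.le, hs.2.trans ht.2⟩
      have hs2 : t - s ∈ Ico 0 T := ⟨by linarith [hs.2], by linarith [hs.1, ht.2]⟩
      rcases le_total s (t - s) with hle | hle
      · have b1 := pow_le_pow_left₀ (hpos s hs1).le (hm hs1 hs2 hle) 2
        have b2 := Real.rpow_le_rpow_of_nonpos hs.1 hle (show α - 1 ≤ 0 by linarith)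
        nlinarith [mul_nonneg (sub_nonneg.2 b1) (sub_nonneg.2 b2)]
      · have b1 := pow_le_pow_left₀ (hpos _ hs2).le (hm hs2 hs1 hle) 2
        have b2 := Real.rpow_le_rpow_of_nonpos (sub_pos.2 hs.2) hle (show α - 1 ≤ 0 by linarith)
        nlinarith [mul_nonneg (sub_nonneg.2 b1) (sub_nonneg.2 b2)]
    rw [intervalIntegral.integral_add i1 i3, intervalIntegral.integral_add i2 i4, a1, a2] at this
    linarith
  set y : ℝ → ℝ := fun t => u0 + c * ∫ s in (0:ℝ)..t, s ^ (α - 1) * u s ^ 2 with hy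
  have hyu : ∀ t ∈ Ico 0 T, y t ≤ u t := by
    intro t ht
    rw [eq t ht]
    have := mul_le_mul_of_nonneg_left (hcheb t ht) hc.le
    simp only [hy]; linarith
  have hy0 : ∀ t ∈ Ico 0 T, 0 < y t := by
    intro t ht
    have : 0 ≤ ∫ s in (0:ℝ)..t, s ^ (α - 1) * u s ^ 2 := by
      apply intervalIntegral.integral_nonneg ht.1
      intro s hs
      exact mul_nonneg (Real.rpow_nonneg hs.1 _) (sq_nonneg _)
    have := mul_nonneg hc.le this
    simp only [hy]; linarith
  have hsub : Icc 0 t1 ⊆ Ico 0 T := fun s hs => ⟨hs.1, hs.2.trans_lt ht1.2⟩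
  have hycont : ContinuousOn y (Icc 0 t1) := by
    apply continuousOn_const.add (continuousOn_const.mul _)
    have := intervalIntegral.continuousOn_primitive_interval (a := 0) (b := t1)
      (f := fun s => s ^ (α - 1) * u s ^ 2) (μ := MeasureTheory.volume) (by
        have := hint t1 ht1
        rw [intervalIntegrable_iff_integrableOn_Icc_of_le ht1.1] at this
        rwa [uIcc_of_le ht1.1])
    rwa [uIcc_of_le ht1.1] at this
  have hyd : ∀ t ∈ Ioo 0 t1, HasDerivAt y (c * (t ^ (α - 1) * u t ^ 2)) t := by
    intro t ht
    have htT : t ∈ Ico 0 T := ⟨ht.1.le, ht.2.trans ht1.2⟩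
    have hco : ContinuousOn (fun s => s ^ (α - 1) * u s ^ 2) (Ioo 0 T) := by
      apply ContinuousOn.mul
      · apply ContinuousOn.rpow_const continuousOn_id
        intro s hs; left; exact hs.1.ne'
      · exact (hu.mono Ioo_subset_Ico_self).pow 2
    have hn : Ioo 0 T ∈ nhds t := Ioo_mem_nhds ht.1 htT.2
    have := intervalIntegral.integral_hasDerivAt_right (hint t htT)
      (hco.stronglyMeasurableAtFilter isOpen_Ioo t ⟨ht.1, htT.2⟩) (hco.continuousAt hn)
    exact (this.const_mul c).const_add u0
  have hanti : AntitoneOn (fun t => (y t)⁻¹ + c * (t ^ α / α)) (Icc 0 t1) := by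
    have hder : ∀ t ∈ Ioo 0 t1, HasDerivAt (fun t => (y t)⁻¹ + c * (t ^ α / α))
        (-(c * (t ^ (α - 1) * u t ^ 2)) / (y t) ^ 2 + c * (α * t ^ (α - 1) / α)) t := by
      intro t ht
      have htT : t ∈ Ico 0 T := ⟨ht.1.le, ht.2.trans ht1.2⟩
      exact ((hyd t ht).inv (hy0 t htT).ne').add
        (((Real.hasDerivAt_rpow_const (Or.inl ht.1.ne')).div_const α).const_mul c)
    apply antitoneOn_of_deriv_nonpos (convex_Icc _ _)
    · apply ContinuousOn.add
      · exact hycont.inv₀ fun t ht => (hy0 t (hsub ht)).ne'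
      · apply continuousOn_const.mul (ContinuousOn.div_const _ _)
        exact ContinuousOn.rpow_const continuousOn_id (fun _ _ => Or.inr hα.le)
    · rw [interior_Icc]
      intro t ht
      exact (hder t ht).differentiableAt.differentiableWithinAt
    · rw [interior_Icc]
      intro t ht
      have htT : t ∈ Ico 0 T := ⟨ht.1.le, ht.2.trans ht1.2⟩
      rw [(hder t ht).deriv]
      have h1 : 1 ≤ u t ^ 2 / y t ^ 2 := by
        rw [one_le_div (pow_pos (hy0 t htT) 2)]
        exact pow_le_pow_left₀ (hy0 t htT).le (hyu t htT) 2
      have h2 : 0 ≤ c * t ^ (α - 1) := mul_nonneg hc.le (Real.rpow_nonneg ht.1.le _)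
      have h3 : -(c * (t ^ (α - 1) * u t ^ 2)) / (y t) ^ 2 + c * (α * t ^ (α - 1) / α)
          = (c * t ^ (α - 1)) * (1 - u t ^ 2 / y t ^ 2) := by
        field_simp; ring
      rw [h3]
      exact mul_nonpos_of_nonneg_of_nonpos h2 (by linarith)
  have := hanti (left_mem_Icc.2 ht1.1) (right_mem_Icc.2 ht1.1) ht1.1
  have hyz : y 0 = u0 := by simp [hy]
  simp only [hyz, Real.zero_rpow hα.ne', zero_div, mul_zero, add_zero] at this
  have := inv_pos.2 (hy0 t1 ht1)
  rw [one_div]; linarith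

end sol

/-- truncated square -/
noncomputable def tsq (K x : ℝ) : ℝ := (max 0 (min x K)) ^ 2

lemma tsq_cont (K : ℝ) : Continuous (tsq K) := by unfold tsq; fun_prop

lemma tsq_le {K : ℝ} (hK : 0 ≤ K) (x : ℝ) : tsq K x ≤ K ^ 2 :=
  pow_le_pow_left₀ (le_max_left _ _) (max_le hK (min_le_right _ _)) 2

lemma tsq_lip {K : ℝ} (hK : 0 ≤ K) (x y : ℝ) : |tsq K x - tsq K y| ≤ 2 * K * |x - y| := by
  have h1 : |max 0 (min x K) - max 0 (min y K)| ≤ |x - y| := by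
    rw [max_comm 0, max_comm 0]
    refine (abs_max_sub_max_le_abs _ _ _).trans ((abs_min_sub_min_le_max x K y K).trans ?_)
    simp
  have a0 : 0 ≤ max 0 (min x K) := le_max_left _ _
  have b0 : 0 ≤ max 0 (min y K) := le_max_left _ _
  have a1 : max 0 (min x K) ≤ K := max_le hK (min_le_right _ _)
  have b1 : max 0 (min y K) ≤ K := max_le hK (min_le_right _ _)
  unfold tsq
  rw [sq_sub_sq, abs_mul, abs_of_nonneg (by linarith)]
  exact mul_le_mul (by linarith) h1 (abs_nonneg _) (by linarith)

open Classical in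
lemma extend {α c u0 T M : ℝ} {u : ℝ → ℝ} (hα : 0 < α) (hα1 : α < 1) (hc : 0 < c) (hu0 : 0 < u0)
    (hT : 0 < T) (hu : ContinuousOn u (Ico 0 T))
    (eq : ∀ t ∈ Ico 0 T, u t = u0 + c * ∫ s in (0:ℝ)..t, (t - s) ^ (α - 1) * u s ^ 2)
    (hM : ∀ t ∈ Ico 0 T, u t ≤ M) :
    ∃ T' > T, ∃ v : ℝ → ℝ, ContinuousOn v (Ico 0 T') ∧
      ∀ t ∈ Ico 0 T', v t = u0 + c * ∫ s in (0:ℝ)..t, (t - s) ^ (α - 1) * v s ^ 2 := by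
  have hpos : ∀ s ∈ Ico 0 T, 0 < u s := fun s hs => hu0.trans_le (sol_ge hc eq hs)
  have hM0 : 0 < M := (hpos 0 ⟨le_rfl, hT⟩).trans_le (hM 0 ⟨le_rfl, hT⟩)
  set K := M + 1 with hKdef
  have hK : 0 < K := by linarith
  set δ : ℝ := (α / (4 * c * K)) ^ (1 / α) with hδ
  have hδ0 : 0 < δ := Real.rpow_pos_of_pos (by positivity) _
  have hδα : δ ^ α = α / (4 * c * K) := by
    rw [hδ, ← Real.rpow_mul (by positivity), one_div_mul_cancel hα.ne', Real.rpow_one]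
  set T1 := T + δ with hT1
  let H : (ℝ → ℝ) → ℝ → ℝ := fun v => (Ico 0 T).piecewise (fun s => u s ^ 2) (fun s => tsq K (v s))
  have Hm : ∀ v : ℝ → ℝ, Continuous v → Measurable (H v) := fun v hv =>
    ContinuousOn.measurable_piecewise (hu.pow 2) ((tsq_cont K).comp hv).continuousOn
      measurableSet_Ico
  have H0 : ∀ v s, 0 ≤ H v s := by
    intro v s
    by_cases hs : s ∈ Ico 0 T
    · simp only [H, piecewise_eq_of_mem _ _ _ hs]; positivity
    · simp only [H, piecewise_eq_of_notMem _ _ _ hs]; exact sq_nonneg _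
  have HB : ∀ v s, H v s ≤ K ^ 2 := by
    intro v s
    by_cases hs : s ∈ Ico 0 T
    · simp only [H, piecewise_eq_of_mem _ _ _ hs]
      exact pow_le_pow_left₀ (hpos s hs).le ((hM s hs).trans (by linarith)) 2
    · simp only [H, piecewise_eq_of_notMem _ _ _ hs]; exact tsq_le hK.le _
  let J : (ℝ → ℝ) → ℝ → ℝ := fun v t => ∫ s in (0:ℝ)..t, (t - s) ^ (α - 1) * H v s
  let p : ℝ → ℝ := fun t => max 0 (min t T1)
  have hT1pos : 0 < T1 := by linarith
  have p0 : ∀ t, 0 ≤ p t := fun t => le_max_left _ _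
  have p1 : ∀ t, p t ≤ T1 := fun t => max_le hT1pos.le (min_le_right _ _)
  have pid : ∀ t, 0 ≤ t → t ≤ T1 → p t = t := by
    intro t h0 h1; simp only [p]; rw [min_eq_left h1, max_eq_right h0]
  have hJc : ∀ v : ℝ → ℝ, Continuous v → Continuous fun t => u0 + c * J v (p t) := by
    intro v hv
    apply continuous_const.add (continuous_const.mul _)
    exact (frac_cont hα hα1 (Hm v hv) (H0 v) (HB v)).comp_continuous (by fun_prop) p0
  have hJ0 : ∀ v t, 0 ≤ t → 0 ≤ J v t := by
    intro v t ht
    apply intervalIntegral.integral_nonneg ht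
    intro s hs
    exact mul_nonneg (Real.rpow_nonneg (by linarith [hs.2]) _) (H0 v s)
  have hJb : ∀ v : ℝ → ℝ, Continuous v → ∀ t, ‖u0 + c * J v (p t)‖ ≤
      u0 + c * (2 * K ^ 2 / α * T1 ^ α) := by
    intro v hv t
    have h1 := holder hα hα1 (Hm v hv) (H0 v) (HB v) le_rfl (p0 t)
    rw [intervalIntegral.integral_same, sub_zero, sub_zero] at h1
    have h2 : J v (p t) ≤ 2 * K ^ 2 / α * T1 ^ α := by
      refine (le_abs_self _).trans (h1.trans ?_)
      exact mul_le_mul_of_nonneg_left (Real.rpow_le_rpow (p0 t) (p1 t) hα.le) (by positivity)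
    have h3 := mul_nonneg hc.le (hJ0 v (p t) (p0 t))
    rw [Real.norm_eq_abs, abs_of_nonneg (by linarith)]
    have := mul_le_mul_of_nonneg_left h2 hc.le
    linarith
  let Φ : BoundedContinuousFunction ℝ ℝ → BoundedContinuousFunction ℝ ℝ := fun v =>
    BoundedContinuousFunction.ofNormedAddCommGroup (fun t => u0 + c * J v (p t))
      (hJc v v.continuous) _ (hJb v v.continuous)
  have hΦ : ∀ v t, Φ v t = u0 + c * J v (p t) := fun v t => rfl
  have hdiff : ∀ (v v' : BoundedContinuousFunction ℝ ℝ) (t : ℝ), 0 ≤ t → t ≤ T1 →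
      |J v t - J v' t| ≤ 2 * K * dist v v' * (δ ^ α / α) := by
    intro v v' t ht0 ht1
    have i1 := fun a b => bdd_int hα (Hm v v.continuous) (H0 v) (HB v) t a b
    have i2 := fun a b => bdd_int hα (Hm v' v'.continuous) (H0 v') (HB v') t a b
    have hsame : ∀ r, 0 ≤ r → r ≤ T → ∫ s in (0:ℝ)..r, (t - s) ^ (α - 1) * H v s =
        ∫ s in (0:ℝ)..r, (t - s) ^ (α - 1) * H v' s := by
      intro r hr hrT
      apply intervalIntegral.integral_congr_Ioo_of_le hr
      intro s hs
      have : s ∈ Ico 0 T := ⟨hs.1.le, hs.2.trans_le hrT⟩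
      simp only [H, piecewise_eq_of_mem _ _ _ this]
    rcases le_total t T with htT | htT
    · simp only [J]
      rw [hsame t ht0 htT, sub_self, abs_zero]
      positivity
    · simp only [J]
      rw [← integral_add_adjacent_intervals (i1 0 T) (i1 T t),
        ← integral_add_adjacent_intervals (i2 0 T) (i2 T t), hsame T hT.le le_rfl,
        add_sub_add_left_eq_sub, ← intervalIntegral.integral_sub (i1 T t) (i2 T t)]
      have hb : |∫ s in T..t, ((t - s) ^ (α - 1) * H v s - (t - s) ^ (α - 1) * H v' s)| ≤
          ∫ s in T..t, (t - s) ^ (α - 1) * (2 * K * dist v v') := by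
        rw [← Real.norm_eq_abs]
        apply intervalIntegral.norm_integral_le_of_norm_le htT _ ((ker_int hα t T t).mul_const _)
        filter_upwards with s hs
        have hk : 0 ≤ (t - s) ^ (α - 1) := Real.rpow_nonneg (by linarith [hs.2]) _
        have hns : s ∉ Ico 0 T := fun h => by linarith [hs.1, h.2]
        rw [← mul_sub, Real.norm_eq_abs, abs_mul, abs_of_nonneg hk]
        apply mul_le_mul_of_nonneg_left _ hk
        simp only [H, piecewise_eq_of_notMem _ _ _ hns]
        refine (tsq_lip hK.le _ _).trans ?_
        apply mul_le_mul_of_nonneg_left _ (by positivity)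
        rw [← Real.dist_eq]
        exact BoundedContinuousFunction.dist_coe_le_dist s
      refine hb.trans ?_
      rw [intervalIntegral.integral_mul_const, ker_val hα, sub_self, Real.zero_rpow hα.ne',
        sub_zero, mul_comm]
      apply mul_le_mul_of_nonneg_left _ (by positivity)
      apply div_le_div_of_nonneg_right _ hα.le
      exact Real.rpow_le_rpow (by linarith) (by linarith) hα.le
  have hcon : ContractingWith (1/2) Φ := by
    refine ⟨by rw [← NNReal.coe_lt_coe]; norm_num, LipschitzWith.of_dist_le_mul fun v v' => ?_⟩
    rw [BoundedContinuousFunction.dist_le (by positivity)]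
    intro t
    rw [hΦ, hΦ, Real.dist_eq, add_sub_add_left_eq_sub, ← mul_sub, abs_mul, abs_of_pos hc]
    refine (mul_le_mul_of_nonneg_left (hdiff v v' (p t) (p0 t) (p1 t)) hc.le).trans ?_
    rw [hδα]
    apply le_of_eq
    push_cast
    field_simp
    ring
  let v := hcon.fixedPoint
  have hv : ∀ t, 0 ≤ t → t ≤ T1 → v t = u0 + c * J v t := by
    intro t h0 h1
    have h2 : Φ v = v := hcon.fixedPoint_isFixedPt
    have h3 := hΦ v t
    rw [h2, pid t h0 h1] at h3
    exact h3
  have hvu : ∀ t ∈ Ico 0 T, v t = u t := by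
    intro t ht
    rw [hv t ht.1 (by linarith [ht.2]), eq t ht]
    congr 2
    apply intervalIntegral.integral_congr_Ioo_of_le ht.1
    intro s hs
    have : s ∈ Ico 0 T := ⟨hs.1.le, hs.2.trans ht.2⟩
    simp only [H, piecewise_eq_of_mem _ _ _ this]
  have hvT : v T ≤ M := by
    have hcl : IsClosed {t | v t ≤ M} := isClosed_le v.continuous continuous_const
    have hsub : Ico 0 T ⊆ {t | v t ≤ M} := fun t ht => by
      simp only [mem_ofPred_eq]; rw [hvu t ht]; exact hM t ht
    have := hcl.closure_subset_iff.2 hsub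
    rw [closure_Ico hT.ne] at this
    exact this ⟨hT.le, le_rfl⟩
  obtain ⟨ε, hε, hball⟩ := Metric.mem_nhds_iff.1
    ((isOpen_lt v.continuous continuous_const).mem_nhds (show T ∈ {t | v t < K} by
      simp only [mem_ofPred_eq]; linarith))
  refine ⟨min T1 (T + ε), lt_min (by linarith) (by linarith), v, v.continuous.continuousOn, ?_⟩
  intro t ht
  have ht1 : t < T1 := ht.2.trans_le (min_le_left _ _)
  have ht2 : t < T + ε := ht.2.trans_le (min_le_right _ _)
  rw [hv t ht.1 ht1.le]
  congr 2
  apply intervalIntegral.integral_congr_Ioo_of_le ht.1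
  intro s hs
  by_cases hsT : s ∈ Ico 0 T
  · simp only [H, piecewise_eq_of_mem _ _ _ hsT]; rw [hvu s hsT]
  · have hTs : T ≤ s := by
      by_contra h
      exact hsT ⟨hs.1.le, not_le.1 h⟩
    have hlt : v s < K := by
      apply hball
      rw [Metric.mem_ball, Real.dist_eq, abs_of_nonneg (by linarith)]
      linarith [hs.2]
    have hge : 0 ≤ v s := by
      rw [hv s hs.1.le (by linarith [hs.2])]
      have := mul_nonneg hc.le (hJ0 v s hs.1.le)
      linarith
    simp only [H, piecewise_eq_of_notMem _ _ _ hsT, tsq]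
    rw [min_eq_left hlt.le, max_eq_right hge]

end FracBlow

/-- Blow-up of the maximal solution of `ᶜD₀₊^α w̃ = (w̃+1/2)²`, `w̃(0)=w₀>0`,
with two-sided bounds on the blow-up time. -/
theorem shifted_quadratic_fractional_blowup (α w₀ : ℝ) (hα : 0 < α) (hα1 : α < 1)
    (hw₀ : 0 < w₀)
    (w : ℝ → ℝ) (Tb : ℝ) (hTb : 0 < Tb)
    (hw : ContinuousOn w (Set.Ico 0 Tb))
    (heq : ∀ t ∈ Set.Ico (0:ℝ) Tb,
      w t = w₀ + (1 / Real.Gamma α) * ∫ s in (0:ℝ)..t, (t - s) ^ (α - 1) * (w s + 1/2) ^ 2)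
    (hmax : ¬ ∃ T' > Tb, ∃ v : ℝ → ℝ, ContinuousOn v (Set.Ico 0 T') ∧
      ∀ t ∈ Set.Ico (0:ℝ) T',
        v t = w₀ + (1 / Real.Gamma α) * ∫ s in (0:ℝ)..t, (t - s) ^ (α - 1) * (v s + 1/2) ^ 2) :
    Filter.Tendsto w (nhdsWithin Tb (Set.Iio Tb)) Filter.atTop ∧
      (Real.Gamma (α + 1) / (4 * (w₀ + 1/2))) ^ (1 / α) ≤ Tb ∧
      Tb ≤ (Real.Gamma (α + 1) / (w₀ + 1/2)) ^ (1 / α) := by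
  have hG : 0 < Real.Gamma α := Real.Gamma_pos_of_pos hα
  have hG1 : Real.Gamma (α + 1) = α * Real.Gamma α := Real.Gamma_add_one hα.ne'
  have hG1p : 0 < Real.Gamma (α + 1) := Real.Gamma_pos_of_pos (by linarith)
  obtain ⟨c, hcdef⟩ : ∃ c, c = 1 / Real.Gamma α := ⟨_, rfl⟩
  have hc : 0 < c := by rw [hcdef]; positivity
  have hcα : ∀ x : ℝ, c * (x / α) = x / Real.Gamma (α + 1) := by
    intro x; rw [hG1, hcdef]; field_simp
  rw [← hcdef] at heq hmax
  obtain ⟨u0, hu0def⟩ : ∃ u0, u0 = w₀ + 1 / 2 := ⟨_, rfl⟩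
  have hu0 : 0 < u0 := by linarith
  rw [← hu0def]
  obtain ⟨u, hudef⟩ : ∃ u : ℝ → ℝ, u = fun t => w t + 1 / 2 := ⟨_, rfl⟩
  have hu : ContinuousOn u (Ico 0 Tb) := by rw [hudef]; exact hw.add continuousOn_const
  have eq : ∀ t ∈ Ico 0 Tb, u t = u0 + c * ∫ s in (0:ℝ)..t, (t - s) ^ (α - 1) * u s ^ 2 := by
    intro t ht
    simp only [hudef]
    linarith [heq t ht]
  have hmono := FracBlow.sol_monoOn hα hc hu0 hu eq
  have hunb : ∀ M, ∃ t ∈ Ico 0 Tb, M < u t := by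
    intro M
    by_contra hcon
    push Not at hcon
    obtain ⟨T', hT', v, hv, hveq⟩ := FracBlow.extend hα hα1 hc hu0 hTb hu eq hcon
    refine hmax ⟨T', hT', fun t => v t - 1 / 2, hv.sub continuousOn_const, ?_⟩
    intro t ht
    simp only [sub_add_cancel]
    linarith [hveq t ht]
  refine ⟨?_, ?_, ?_⟩
  · rw [Filter.tendsto_atTop]
    intro M
    obtain ⟨t0, ht0, hM⟩ := hunb (M + 1 / 2)
    filter_upwards [Ioo_mem_nhdsLT ht0.2] with t ht
    have := hmono ht0 ⟨ht0.1.trans ht.1.le, ht.2⟩ ht.1.le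
    rw [hudef] at this hM
    simp only at this hM
    linarith
  · have hcmp : Real.Gamma (α + 1) / (4 * u0) ≤ Tb ^ α := by
      obtain ⟨t1, ht1, hlt⟩ := hunb (2 * u0)
      have h0 : u 0 = u0 := by rw [eq 0 ⟨le_rfl, hTb⟩]; simp
      have hsub : Icc 0 t1 ⊆ Ico 0 Tb := fun s hs => ⟨hs.1, hs.2.trans_lt ht1.2⟩
      obtain ⟨t, ht, hut⟩ := intermediate_value_Icc ht1.1 (hu.mono hsub)
        (show 2 * u0 ∈ Icc (u 0) (u t1) from ⟨by linarith, hlt.le⟩)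
      have hq := FracBlow.sol_quad hα hc hu0 hu eq (hsub ht)
      have hp : t ^ α ≤ Tb ^ α := Real.rpow_le_rpow ht.1 (hsub ht).2.le hα.le
      rw [hut, ← mul_assoc, hcα] at hq
      have h1 : 1 ≤ t ^ α / Real.Gamma (α + 1) * (4 * u0) := by
        by_contra hn
        push Not at hn
        have := mul_lt_mul_of_pos_right hn hu0
        nlinarith
      rw [div_mul_eq_mul_div, one_le_div hG1p] at h1
      rw [div_le_iff₀ (by positivity)]
      nlinarith
    calc _ ≤ (Tb ^ α) ^ (1 / α) :=
          Real.rpow_le_rpow (by positivity) hcmp (by positivity)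
      _ = Tb := by rw [← Real.rpow_mul hTb.le, mul_one_div_cancel hα.ne', Real.rpow_one]
  · have hall : ∀ t ∈ Ico 0 Tb, t ≤ (Real.Gamma (α + 1) / u0) ^ (1 / α) := by
      intro t ht
      have h1 := FracBlow.sol_upper hα hα1 hc hu0 hu eq ht
      rw [hcα, div_lt_div_iff₀ hG1p hu0, one_mul] at h1
      have h2 : t ^ α ≤ Real.Gamma (α + 1) / u0 := by
        rw [le_div_iff₀ hu0]; exact h1.le
      calc t = (t ^ α) ^ (1 / α) := by
            rw [← Real.rpow_mul ht.1, mul_one_div_cancel hα.ne', Real.rpow_one]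
        _ ≤ _ := Real.rpow_le_rpow (Real.rpow_nonneg ht.1 _) h2 (by positivity)
    refine le_of_forall_lt_imp_le_of_dense fun t ht => ?_
    rcases le_total 0 t with h | h
    · exact hall t ⟨h, ht⟩
    · exact h.trans (Real.rpow_nonneg (by positivity) _)
end

section
/- Let 0<α<1 and u₀<1, and suppose u is continuous on [0,T) with u(0)=u₀ and satisfies the Volterra equation u(t) = u₀ − (1/Γ(α))∫₀ᵗ (t−s)^{α−1} u(s)(1−u(s)) ds. If u(t₀)=1 for some t₀∈(0,T) with u(t)<1 on [0,t₀), then a contradiction arises; hence u(t) < 1 for all t∈[0,T). -/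
open Set intervalIntegral

open MeasureTheory in
lemma aux_base_integrable (α : ℝ) (hα : 0 < α) (hα1 : α < 1) :
    IntegrableOn (fun z : ℝ => z ^ (α - 1) / (1 + z)) (Ioi 0) := by
  have hm : Measurable (fun z : ℝ => z ^ (α - 1) / (1 + z)) := by fun_prop
  rw [← Ioc_union_Ioi_eq_Ioi (zero_le_one (α := ℝ))]
  refine IntegrableOn.union ?_ ?_
  · have h1 : IntegrableOn (fun z : ℝ => z ^ (α - 1)) (Ioc 0 1) := by
      rw [← intervalIntegrable_iff_integrableOn_Ioc_of_le zero_le_one]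
      exact intervalIntegral.intervalIntegrable_rpow' (by linarith)
    refine Integrable.mono' h1 hm.aestronglyMeasurable ?_
    refine (ae_restrict_iff' measurableSet_Ioc).2 (Filter.Eventually.of_forall fun z hz => ?_)
    have hz0 : 0 < z := hz.1
    have hp : 0 < z ^ (α - 1) := Real.rpow_pos_of_pos hz0 _
    rw [Real.norm_of_nonneg (by positivity)]
    exact div_le_self hp.le (by linarith)
  · have h1 : IntegrableOn (fun z : ℝ => z ^ (α - 2)) (Ioi 1) :=
      integrableOn_Ioi_rpow_of_lt (by linarith) zero_lt_one
    refine Integrable.mono' h1 hm.aestronglyMeasurable ?_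
    refine (ae_restrict_iff' measurableSet_Ioi).2 (Filter.Eventually.of_forall fun z hz => ?_)
    have hz1 : (1:ℝ) < z := hz
    have hz0 : 0 < z := by linarith
    have hp : 0 < z ^ (α - 1) := Real.rpow_pos_of_pos hz0 _
    rw [Real.norm_of_nonneg (by positivity)]
    have : z ^ (α - 2) = z ^ (α - 1) / z := by
      rw [← Real.rpow_sub_one hz0.ne']; ring_nf
    rw [this]
    exact div_le_div_of_nonneg_left hp.le hz0 (by linarith)

open MeasureTheory in
lemma aux_base_pos (α : ℝ) (hα : 0 < α) (hα1 : α < 1) :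
    0 < ∫ z in Ioi (0:ℝ), z ^ (α - 1) / (1 + z) := by
  rw [setIntegral_pos_iff_support_of_nonneg_ae _ (aux_base_integrable α hα hα1)]
  · have : Ioi (0:ℝ) ⊆ Function.support (fun z : ℝ => z ^ (α - 1) / (1 + z)) ∩ Ioi 0 := by
      intro z hz
      have hz0 : 0 < z := hz
      refine ⟨?_, hz⟩
      have hp : 0 < z ^ (α - 1) := Real.rpow_pos_of_pos hz0 _
      exact (by positivity : (0:ℝ) < z ^ (α - 1) / (1 + z)).ne'
    refine lt_of_lt_of_le ?_ (measure_mono this)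
    simp
  · refine (ae_restrict_iff' measurableSet_Ioi).2 (Filter.Eventually.of_forall fun z hz => ?_)
    have hz0 : 0 < z := hz
    have hp : 0 < z ^ (α - 1) := Real.rpow_pos_of_pos hz0 _
    exact (by positivity : (0:ℝ) ≤ z ^ (α - 1) / (1 + z))

lemma aux_algebra (α a b c z : ℝ) (ha : 0 < a) (hb : 0 < b) (hc : 0 < c) (hz : 0 < z) :
    (a * c * b / (a + c * z) ^ 2) * ((c * z * b / (a + c * z)) ^ (α - 1) *
      ((a * b / (a + c * z)) ^ (-α) / (a * c * (1 + z) / (a + c * z)))) =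
    c ^ (α - 1) * a ^ (-α) * (z ^ (α - 1) / (1 + z)) := by
  have hD : 0 < a + c * z := by positivity
  have e1 : (c * z * b / (a + c * z)) ^ (α - 1) =
      c ^ (α - 1) * z ^ (α - 1) * (b / (a + c * z)) ^ (α - 1) := by
    rw [mul_div_assoc, Real.mul_rpow (by positivity) (by positivity),
      Real.mul_rpow hc.le hz.le]
  have e2 : (a * b / (a + c * z)) ^ (-α) = a ^ (-α) * (b / (a + c * z)) ^ (-α) := by
    rw [mul_div_assoc, Real.mul_rpow (by positivity) (by positivity)]
  have hq : 0 < b / (a + c * z) := by positivity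
  have e3 : (b / (a + c * z)) ^ (α - 1) * (b / (a + c * z)) ^ (-α) = (a + c * z) / b := by
    rw [← Real.rpow_add hq, show α - 1 + -α = -1 by ring, Real.rpow_neg_one, inv_div]
  rw [e1, e2]
  calc _ = c ^ (α - 1) * z ^ (α - 1) * a ^ (-α) *
        ((b / (a + c * z)) ^ (α - 1) * (b / (a + c * z)) ^ (-α)) *
        ((a * c * b / (a + c * z) ^ 2) / (a * c * (1 + z) / (a + c * z))) := by ring
    _ = _ := by
      rw [e3]
      field_simp

open MeasureTheory in
lemma aux_subst (α : ℝ) (hα : 0 < α) (hα1 : α < 1) (s t₁ t₀ : ℝ) (hs : s < t₁) (ht : t₁ < t₀) :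
    IntegrableOn (fun r : ℝ => (r - s) ^ (α - 1) * ((t₁ - r) ^ (-α) / (t₀ - r))) (Ioo s t₁) ∧
    ∫ r in Ioo s t₁, (r - s) ^ (α - 1) * ((t₁ - r) ^ (-α) / (t₀ - r)) =
      (t₀ - s) ^ (α - 1) * (t₀ - t₁) ^ (-α) * ∫ z in Ioi (0:ℝ), z ^ (α - 1) / (1 + z) := by
  have ha : 0 < t₀ - t₁ := by linarith
  have hb : 0 < t₁ - s := by linarith
  have hc : 0 < t₀ - s := by linarith
  set a := t₀ - t₁ with hadef
  set b := t₁ - s with hbdef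
  set c := t₀ - s with hcdef
  have hD : ∀ z ∈ Ioi (0:ℝ), 0 < a + c * z := fun z hz => by
    have : (0:ℝ) < z := hz
    positivity
  let φ : ℝ → ℝ := fun z => s + c * z * b / (a + c * z)
  have hderiv : ∀ z ∈ Ioi (0:ℝ),
      HasDerivWithinAt φ (a * c * b / (a + c * z) ^ 2) (Ioi 0) z := by
    intro z hz
    have hD' := (hD z hz).ne'
    have h1 : HasDerivAt (fun z : ℝ => c * z * b) (c * 1 * b) z :=
      ((hasDerivAt_id z).const_mul c).mul_const b
    have h2 : HasDerivAt (fun z : ℝ => a + c * z) (c * 1) z :=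
      ((hasDerivAt_id z).const_mul c).const_add a
    have h3 := ((h1.div h2 hD').const_add s).hasDerivWithinAt (s := Ioi 0)
    refine h3.congr_deriv ?_
    congr 1
    ring
  have hinj : InjOn φ (Ioi 0) := by
    intro x hx y hy hxy
    have h1 := (hD x hx).ne'
    have h2 := (hD y hy).ne'
    simp only [φ, add_right_inj] at hxy
    rw [div_eq_div_iff h1 h2] at hxy
    have : (a * b * c) * (x - y) = 0 := by linear_combination hxy
    have h3 : a * b * c ≠ 0 := by positivity
    rcases mul_eq_zero.1 this with h | h
    · exact absurd h h3
    · linarith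
  have himg : φ '' Ioi 0 = Ioo s t₁ := by
    ext r
    constructor
    · rintro ⟨z, hz, rfl⟩
      have hz0 : (0:ℝ) < z := hz
      have h1 := hD z hz
      refine ⟨?_, ?_⟩
      · have : 0 < c * z * b / (a + c * z) := by positivity
        simp only [φ]; linarith
      · have : c * z * b / (a + c * z) < b := by
          rw [div_lt_iff₀ h1]; nlinarith [mul_pos ha hb]
        simp only [φ]; linarith
    · rintro ⟨h1, h2⟩
      have h3 : 0 < r - s := by linarith
      have h4 : 0 < t₁ - r := by linarith
      refine ⟨a * (r - s) / (c * (t₁ - r)), ?_, ?_⟩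
      · show (0:ℝ) < _
        positivity
      · simp only [φ]
        have : a + c * (a * (r - s) / (c * (t₁ - r))) = a * b / (t₁ - r) := by
          field_simp
          rw [hbdef]; ring
        rw [this]
        field_simp
        ring
  have hpt : ∀ z ∈ Ioi (0:ℝ), |a * c * b / (a + c * z) ^ 2| •
      ((φ z - s) ^ (α - 1) * ((t₁ - φ z) ^ (-α) / (t₀ - φ z))) =
      c ^ (α - 1) * a ^ (-α) * (z ^ (α - 1) / (1 + z)) := by
    intro z hz
    have hz0 : (0:ℝ) < z := hz
    have h1 := hD z hz
    rw [abs_of_pos (by positivity), smul_eq_mul, ← aux_algebra α a b c z ha hb hc hz0]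
    have e1 : φ z - s = c * z * b / (a + c * z) := by simp [φ]
    have e2 : t₁ - φ z = a * b / (a + c * z) := by
      simp only [φ]
      rw [show t₁ - (s + c * z * b / (a + c * z)) = b - c * z * b / (a + c * z) by
        rw [hbdef]; ring]
      field_simp
      ring
    have e3 : t₀ - φ z = a * c * (1 + z) / (a + c * z) := by
      simp only [φ]
      rw [show t₀ - (s + c * z * b / (a + c * z)) = c - c * z * b / (a + c * z) by
        rw [hcdef]; ring]
      have : b = c - a := by rw [hbdef, hcdef, hadef]; ring
      rw [this]
      field_simp
      ring
    rw [e1, e2, e3]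
  constructor
  · rw [← himg, integrableOn_image_iff_integrableOn_abs_deriv_smul measurableSet_Ioi hderiv hinj]
    rw [integrableOn_congr_fun hpt measurableSet_Ioi]
    exact (aux_base_integrable α hα hα1).const_mul _
  · rw [← himg, integral_image_eq_integral_abs_deriv_smul measurableSet_Ioi hderiv hinj,
      setIntegral_congr_fun measurableSet_Ioi hpt, MeasureTheory.integral_const_mul]

open MeasureTheory in
lemma aux_history (α : ℝ) (hα : 0 < α) (hα1 : α < 1) (t₁ t₀ m : ℝ) (h0 : 0 < t₁) (ht : t₁ < t₀)
    (f : ℝ → ℝ) (hf : Continuous f)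
    (hm : ∀ r ∈ Ioo 0 t₁, -m ≤ ∫ s in Ioo 0 r, (r - s) ^ (α - 1) * f s) (hm0 : 0 ≤ m) :
    -m * (t₁ ^ (1 - α) * t₀ ^ (α - 1)) ≤ ∫ s in Ioo 0 t₁, (t₀ - s) ^ (α - 1) * f s := by
  set B := ∫ z in Ioi (0:ℝ), z ^ (α - 1) / (1 + z) with hB
  have hBpos : 0 < B := aux_base_pos α hα hα1
  set A := (t₀ - t₁) ^ (-α) with hA
  have hApos : 0 < A := Real.rpow_pos_of_pos (by linarith) _
  let K : ℝ → ℝ := fun r => (t₁ - r) ^ (-α) / (t₀ - r)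
  have hK : ∀ r ∈ Ioo 0 t₁, 0 < K r := fun r hr =>
    div_pos (Real.rpow_pos_of_pos (by linarith [hr.2]) _) (by linarith [hr.2])
  let μ : Measure ℝ := volume.restrict (Ioo 0 t₁)
  -- the kernel on the triangle
  let Φ : ℝ × ℝ → ℝ := fun p => f p.1 * (Ioi p.1).indicator
    (fun r => (r - p.1) ^ (α - 1) * K r) p.2
  have hΦm : Measurable Φ := by
    have : Φ = fun p : ℝ × ℝ => f p.1 * ({p : ℝ × ℝ | p.1 < p.2}.indicator
        (fun p => (p.2 - p.1) ^ (α - 1) * ((t₁ - p.2) ^ (-α) / (t₀ - p.2))) p) := by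
      funext p
      simp only [Φ, K, indicator, mem_Ioi, mem_ofPred_eq]
    rw [this]
    refine (hf.measurable.comp measurable_fst).mul ?_
    refine Measurable.indicator ?_ (measurableSet_lt measurable_fst measurable_snd)
    fun_prop
  have hrestr : ∀ s ∈ Ioo 0 t₁, ∀ g : ℝ → ℝ,
      ∫ r in Ioo 0 t₁, (Ioi s).indicator g r = ∫ r in Ioo s t₁, g r := by
    intro s hs g
    rw [setIntegral_indicator measurableSet_Ioi]
    congr 2
    ext r
    simp only [mem_inter_iff, mem_Ioo, mem_Ioi]
    constructor
    · rintro ⟨⟨_, h⟩, h'⟩; exact ⟨h', h⟩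
    · rintro ⟨h, h'⟩; exact ⟨⟨hs.1.trans h, h'⟩, h⟩
  have hsec : ∀ s ∈ Ioo 0 t₁, Integrable ((Ioi s).indicator
      (fun r => (r - s) ^ (α - 1) * K r)) μ := by
    intro s hs
    rw [integrable_indicator_iff measurableSet_Ioi]
    show Integrable _ ((volume.restrict (Ioo 0 t₁)).restrict (Ioi s))
    rw [Measure.restrict_restrict measurableSet_Ioi]
    have h := (aux_subst α hα hα1 s t₁ t₀ hs.2 ht).1
    refine IntegrableOn.mono_set h ?_
    rintro r ⟨h1, h2⟩
    exact ⟨h1, h2.2⟩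
  have hsecint : ∀ s ∈ Ioo 0 t₁, ∫ r, (Ioi s).indicator
      (fun r => (r - s) ^ (α - 1) * K r) r ∂μ = (t₀ - s) ^ (α - 1) * A * B := by
    intro s hs
    rw [hrestr s hs]
    exact (aux_subst α hα hα1 s t₁ t₀ hs.2 ht).2
  have hsecnn : ∀ s ∈ Ioo 0 t₁, ∀ r ∈ Ioo 0 t₁, 0 ≤ (Ioi s).indicator
      (fun r => (r - s) ^ (α - 1) * K r) r := by
    intro s hs r hr
    by_cases h : r ∈ Ioi s
    · rw [indicator_of_mem h]
      have : s < r := h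
      exact mul_nonneg (Real.rpow_nonneg (by linarith) _) (hK r hr).le
    · rw [indicator_of_notMem h]
  have hcont : ContinuousOn (fun s : ℝ => (t₀ - s) ^ (α - 1)) (Icc 0 t₁) := by
    intro s hs
    refine ContinuousAt.continuousWithinAt ?_
    refine ContinuousAt.rpow_const (by fun_prop) (Or.inl ?_)
    linarith [hs.2]
  have hΦi : Integrable Φ (μ.prod μ) := by
    rw [integrable_prod_iff hΦm.aestronglyMeasurable]
    constructor
    · refine (ae_restrict_iff' measurableSet_Ioo).2 (Filter.Eventually.of_forall fun s hs => ?_)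
      exact (hsec s hs).const_mul (f s)
    · have h1 : IntegrableOn (fun s => |f s| * ((t₀ - s) ^ (α - 1) * A * B)) (Ioo 0 t₁) := by
        refine IntegrableOn.mono_set (t := Icc 0 t₁) ?_ Ioo_subset_Icc_self
        refine ContinuousOn.integrableOn_Icc ?_
        exact (hf.abs.continuousOn).mul ((hcont.mul continuousOn_const).mul continuousOn_const)
      refine Integrable.congr h1 ?_
      refine (ae_restrict_iff' measurableSet_Ioo).2 (Filter.Eventually.of_forall fun s hs => ?_)
      show |f s| * ((t₀ - s) ^ (α - 1) * A * B) = ∫ r, ‖Φ (s, r)‖ ∂μ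
      rw [← hsecint s hs, ← MeasureTheory.integral_const_mul]
      refine setIntegral_congr_fun measurableSet_Ioo fun r hr => ?_
      simp only [Φ, Real.norm_eq_abs, abs_mul]
      rw [abs_of_nonneg (hsecnn s hs r hr)]
  have hswap := integral_integral_swap (f := fun s r => Φ (s, r)) hΦi
  have hL : ∫ s, ∫ r, Φ (s, r) ∂μ ∂μ = A * B * ∫ s in Ioo 0 t₁, (t₀ - s) ^ (α - 1) * f s := by
    rw [← MeasureTheory.integral_const_mul]
    refine setIntegral_congr_fun measurableSet_Ioo fun s hs => ?_
    simp only [Φ]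
    rw [MeasureTheory.integral_const_mul, hsecint s hs]
    ring
  have hR : ∀ r ∈ Ioo 0 t₁, ∫ s, Φ (s, r) ∂μ =
      K r * ∫ s in Ioo 0 r, (r - s) ^ (α - 1) * f s := by
    intro r hr
    rw [← MeasureTheory.integral_const_mul]
    have e : ∀ s, Φ (s, r) = (Iio r).indicator
        (fun s => K r * ((r - s) ^ (α - 1) * f s)) s := by
      intro s
      by_cases h : s < r
      · simp only [Φ]
        rw [indicator_of_mem (show r ∈ Ioi s from h), indicator_of_mem (show s ∈ Iio r from h)]
        ring
      · simp only [Φ]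
        rw [indicator_of_notMem (show r ∉ Ioi s from h),
          indicator_of_notMem (show s ∉ Iio r from h), mul_zero]
    simp_rw [e]
    rw [setIntegral_indicator measurableSet_Iio]
    congr 2
    ext s
    simp only [mem_inter_iff, mem_Ioo, mem_Iio]
    constructor
    · rintro ⟨⟨h, _⟩, h'⟩; exact ⟨h, h'⟩
    · rintro ⟨h, h'⟩; exact ⟨⟨h, h'.trans hr.2⟩, h'⟩
  have h00 := aux_subst α hα hα1 0 t₁ t₀ h0 ht
  simp only [sub_zero] at h00
  have hlow : ∫ r in Ioo 0 t₁, (-m * t₁ ^ (1 - α)) * (r ^ (α - 1) * K r) ≤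
      ∫ r, ∫ s, Φ (s, r) ∂μ ∂μ := by
    refine setIntegral_mono_on (h00.1.const_mul _) hΦi.integral_prod_right measurableSet_Ioo ?_
    intro r hr
    rw [hR r hr]
    have h1 := hm r hr
    have h2 : 1 ≤ t₁ ^ (1 - α) * r ^ (α - 1) := by
      have h3 : r ^ (1 - α) ≤ t₁ ^ (1 - α) :=
        Real.rpow_le_rpow hr.1.le hr.2.le (by linarith)
      have h4 : 0 < r ^ (α - 1) := Real.rpow_pos_of_pos hr.1 _
      calc 1 = r ^ (1 - α) * r ^ (α - 1) := by
            rw [← Real.rpow_add hr.1]; simp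
        _ ≤ _ := mul_le_mul_of_nonneg_right h3 h4.le
    have h5 : -m * (t₁ ^ (1 - α) * r ^ (α - 1)) ≤ -m := by nlinarith
    have h6 := mul_le_mul_of_nonneg_left (h5.trans h1) (hK r hr).le
    linarith
  rw [MeasureTheory.integral_const_mul] at hlow
  have h00' : ∫ r in Ioo 0 t₁, r ^ (α - 1) * K r = t₀ ^ (α - 1) * A * B := h00.2
  rw [h00', ← hswap, hL] at hlow
  have hAB : 0 < A * B := mul_pos hApos hBpos
  refine le_of_mul_le_mul_left ?_ hAB
  linarith

/-- The constant `1` is an upper solution: a solution of the Volterra equation for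
`ᶜD₀₊^α u = −u(1−u)` with `u(0)=u₀<1` stays below `1`. -/
theorem solution_stays_below_one (α u₀ T : ℝ) (hα : 0 < α) (hα1 : α < 1) (hu₀ : u₀ < 1)
    (u : ℝ → ℝ) (hu : ContinuousOn u (Set.Ico 0 T)) (hu0 : u 0 = u₀)
    (heq : ∀ t ∈ Set.Ico (0:ℝ) T,
      u t = u₀ - (1 / Real.Gamma α) * ∫ s in (0:ℝ)..t, (t - s) ^ (α - 1) * (u s * (1 - u s))) :
    ∀ t ∈ Set.Ico (0:ℝ) T, u t < 1 := by
  intro t ht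
  by_contra! hcon
  have hG : 0 < Real.Gamma α := Real.Gamma_pos_of_pos hα
  -- first touching time
  have hcI : ContinuousOn u (Icc 0 t) :=
    hu.mono fun x hx => ⟨hx.1, hx.2.trans_lt ht.2⟩
  let S : Set ℝ := Icc 0 t ∩ u ⁻¹' Ici 1
  have hScl : IsClosed S := hcI.preimage_isClosed_of_isClosed isClosed_Icc isClosed_Ici
  have hSne : S.Nonempty := ⟨t, ⟨ht.1, le_rfl⟩, hcon⟩
  have hSbd : BddBelow S := ⟨0, fun x hx => hx.1.1⟩
  set t₀ := sInf S with ht₀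
  have hmem : t₀ ∈ S := hScl.csInf_mem hSne hSbd
  have hbefore : ∀ r, 0 ≤ r → r < t₀ → u r < 1 := by
    intro r h0 hr
    by_contra! h
    exact absurd (csInf_le hSbd (show r ∈ S from ⟨⟨h0, hr.le.trans hmem.1.2⟩, h⟩)) (not_le.2 hr)
  have hut : 1 ≤ u t₀ := hmem.2
  have ht0pos : 0 < t₀ := by
    rcases hmem.1.1.eq_or_lt with h | h
    · rw [← h, hu0] at hut; linarith
    · exact h
  have ht0T : t₀ < T := hmem.1.2.trans_lt ht.2
  -- a time `t₁ < t₀` after which `u` is positive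
  have hca : ContinuousAt u t₀ := hu.continuousAt (Ico_mem_nhds ht0pos ht0T)
  have hev : ∀ᶠ r in nhds t₀, 0 < u r := hca.eventually (lt_mem_nhds (by linarith))
  obtain ⟨l, hl, hlu⟩ := exists_Ioc_subset_of_mem_nhds hev ⟨0, ht0pos⟩
  obtain ⟨t₁, h1, h2⟩ := exists_between (max_lt ht0pos hl)
  have ht1pos : 0 < t₁ := (le_max_left _ _).trans_lt h1
  have hlt1 : l < t₁ := (le_max_right _ _).trans_lt h1
  -- global continuous version
  let w : ℝ → ℝ := IccExtend ht0pos.le ((Icc 0 t₀).domRestrict u)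
  have hw : Continuous w :=
    (continuousOn_iff_continuous_domRestrict.1
      (hu.mono fun x hx => ⟨hx.1, hx.2.trans_lt ht0T⟩)).Icc_extend'
  have hwu : ∀ s ∈ Icc 0 t₀, w s = u s := fun s hs => by
    simp [w, IccExtend_of_mem _ _ hs]
  let f : ℝ → ℝ := fun s => w s * (1 - w s)
  have hf : Continuous f := by fun_prop
  have hfe : ∀ r ∈ Icc 0 t₀, ∫ s in (0:ℝ)..r, (r - s) ^ (α - 1) * (u s * (1 - u s)) =
      ∫ s in (0:ℝ)..r, (r - s) ^ (α - 1) * f s := by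
    intro r hr
    refine intervalIntegral.integral_congr fun s hs => ?_
    rw [uIcc_of_le hr.1] at hs
    simp only [f]
    rw [hwu s ⟨hs.1, hs.2.trans hr.2⟩]
  have hval : ∀ r ∈ Icc 0 t₀, ∫ s in (0:ℝ)..r, (r - s) ^ (α - 1) * f s =
      Real.Gamma α * (u₀ - u r) := by
    intro r hr
    have h := heq r ⟨hr.1, hr.2.trans_lt ht0T⟩
    rw [hfe r hr] at h
    rw [h]
    field_simp
    ring
  have hII : ∀ r ∈ Icc 0 t₀, ∫ s in Ioo 0 r, (r - s) ^ (α - 1) * f s =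
      ∫ s in (0:ℝ)..r, (r - s) ^ (α - 1) * f s := by
    intro r hr
    rw [intervalIntegral.integral_of_le hr.1, MeasureTheory.integral_Ioc_eq_integral_Ioo]
  have hm0 : 0 < Real.Gamma α * (1 - u₀) := mul_pos hG (by linarith)
  have key := aux_history α hα hα1 t₁ t₀ (Real.Gamma α * (1 - u₀)) ht1pos h2 f hf (by
    intro r hr
    have hr' : r ∈ Icc 0 t₀ := ⟨hr.1.le, (hr.2.trans h2).le⟩
    rw [hII r hr', hval r hr']
    have := hbefore r hr.1.le (hr.2.trans h2)
    nlinarith) hm0.le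
  rw [← MeasureTheory.integral_Ioc_eq_integral_Ioo,
    ← intervalIntegral.integral_of_le ht1pos.le] at key
  have hint : ∀ x y : ℝ, IntervalIntegrable (fun s => (t₀ - s) ^ (α - 1) * f s)
      MeasureTheory.volume x y := by
    intro x y
    refine IntervalIntegrable.mul_continuousOn ?_ hf.continuousOn
    have := (intervalIntegral.intervalIntegrable_rpow' (a := t₀ - x) (b := t₀ - y)
      (r := α - 1) (by linarith)).comp_sub_left t₀
    simpa using this
  have hpos : 0 ≤ ∫ s in t₁..t₀, (t₀ - s) ^ (α - 1) * f s := by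
    refine intervalIntegral.integral_nonneg h2.le fun s hs => ?_
    have hs' : s ∈ Icc 0 t₀ := ⟨ht1pos.le.trans hs.1, hs.2⟩
    rcases hs.2.eq_or_lt with h | h
    · rw [h, sub_self, Real.zero_rpow (by linarith), zero_mul]
    · refine mul_nonneg (Real.rpow_nonneg (by linarith) _) ?_
      simp only [f]
      rw [hwu s hs']
      have ha : 0 < u s := hlu ⟨hlt1.trans_le hs.1, hs.2⟩
      have hb := hbefore s hs'.1 h
      exact mul_nonneg ha.le (by linarith)
  have hsum := intervalIntegral.integral_add_adjacent_intervals (hint 0 t₁) (hint t₁ t₀)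
  rw [hval t₀ ⟨ht0pos.le, le_rfl⟩] at hsum
  have hlt : t₁ ^ (1 - α) * t₀ ^ (α - 1) < 1 := by
    have h3 : t₁ ^ (1 - α) < t₀ ^ (1 - α) := Real.rpow_lt_rpow ht1pos.le h2 (by linarith)
    have h4 : 0 < t₀ ^ (α - 1) := Real.rpow_pos_of_pos ht0pos _
    calc _ < t₀ ^ (1 - α) * t₀ ^ (α - 1) := mul_lt_mul_of_pos_right h3 h4
      _ = 1 := by rw [← Real.rpow_add ht0pos]; simp
  have h7 : Real.Gamma α * (u₀ - u t₀) ≤ -(Real.Gamma α * (1 - u₀)) := by nlinarith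
  have h8 := mul_lt_mul_of_pos_left hlt hm0
  linarith
end
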